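/- arXiv:2111.06820 — 12 statements merged into one kernel-verified Lean document; each statement's English description precedes it below -/
import Mathlib

section
/- Let m ≥ 1 and let 𝒳 ⊆ ℝ^m_{≥0} be a nonempty convex set. Then sup_{p ∈ Δ_m} inf_{x ∈ 𝒳} ⟨p, x⟩ = inf_{x ∈ 𝒳} max_{r ∈ {1,…,m}} x_r, i.e., the optimal value of the dual of the min-max resource sharing problem equals the optimal primal value λ*. -/
open scoped BigOperators

/-- For `m ≥ 1` and a nonempty convex set `𝒳 ⊆ ℝ^m_{≥0}`, the optimal
value of the dual of the min-max resource sharing problem equals the optimal primal value: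
`sup_{p ∈ Δ_m} inf_{x ∈ 𝒳} ⟨p, x⟩ = inf_{x ∈ 𝒳} max_r x_r`. -/
theorem stmt_0 (m : ℕ) (hm : 1 ≤ m) (𝒳 : Set (Fin m → ℝ))
    (hne : 𝒳.Nonempty) (hconv : Convex ℝ 𝒳)
    (hnonneg : ∀ x ∈ 𝒳, ∀ r, 0 ≤ x r) :
    (⨆ p : {p : Fin m → ℝ // (∀ r, 0 ≤ p r ∧ p r ≤ 1) ∧ ∑ r, p r = 1},
        ⨅ x : 𝒳, ∑ r, (p : Fin m → ℝ) r * (x : Fin m → ℝ) r)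
      = ⨅ x : 𝒳, ⨆ r, (x : Fin m → ℝ) r := by
  haveI : Nonempty (Fin m) := ⟨⟨0, hm⟩⟩
  haveI : Nonempty 𝒳 := hne.to_subtype
  have hle : ∀ (x : Fin m → ℝ) (r : Fin m), x r ≤ ⨆ r, x r := fun x r =>
    le_ciSup (Set.finite_range x).bddAbove r
  have hbdd : BddBelow (Set.range fun x : 𝒳 => ⨆ r, (x : Fin m → ℝ) r) := by
    refine ⟨0, ?_⟩
    rintro _ ⟨x, rfl⟩
    exact (hnonneg x x.2 ⟨0, hm⟩).trans (hle x _)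
  -- weak duality
  have hweak : ∀ p : {p : Fin m → ℝ // (∀ r, 0 ≤ p r ∧ p r ≤ 1) ∧ ∑ r, p r = 1},
      (⨅ x : 𝒳, ∑ r, (p : Fin m → ℝ) r * (x : Fin m → ℝ) r)
        ≤ ⨅ x : 𝒳, ⨆ r, (x : Fin m → ℝ) r := by
    intro p
    refine ciInf_mono ?_ ?_
    · refine ⟨0, ?_⟩
      rintro _ ⟨x, rfl⟩
      exact Finset.sum_nonneg fun r _ => mul_nonneg (p.2.1 r).1 (hnonneg x x.2 r)
    · intro x
      calc ∑ r, (p : Fin m → ℝ) r * (x : Fin m → ℝ) r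
          ≤ ∑ r, (p : Fin m → ℝ) r * ⨆ r, (x : Fin m → ℝ) r :=
            Finset.sum_le_sum fun r _ => mul_le_mul_of_nonneg_left (hle x r) (p.2.1 r).1
        _ = ⨆ r, (x : Fin m → ℝ) r := by rw [← Finset.sum_mul, p.2.2, one_mul]
  haveI : Nonempty {p : Fin m → ℝ // (∀ r, 0 ≤ p r ∧ p r ≤ 1) ∧ ∑ r, p r = 1} := by
    refine ⟨⟨Pi.single ⟨0, hm⟩ 1, fun r => ?_, by simp⟩⟩
    by_cases h : r = ⟨0, hm⟩
    · subst h; simp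
    · simp [Pi.single_eq_of_ne h]
  refine le_antisymm (ciSup_le hweak) ?_
  set L : ℝ := ⨅ x : 𝒳, ⨆ r, (x : Fin m → ℝ) r with hL
  -- separation
  have hdisj : Disjoint (Set.pi Set.univ fun _ : Fin m => Set.Iio L) 𝒳 := by
    rw [Set.disjoint_left]
    intro x hx hxX
    obtain ⟨r, hr⟩ := exists_eq_ciSup_of_finite (f := x)
    have h1 : L ≤ ⨆ r, x r := ciInf_le hbdd ⟨x, hxX⟩
    have h2 : x r < L := hx r (Set.mem_univ r)
    linarith
  obtain ⟨f, u, hf1, hf2⟩ := geometric_hahn_banach_open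
    (convex_pi fun _ _ => convex_Iio L) (isOpen_set_pi Set.finite_univ fun _ _ => isOpen_Iio)
    hconv hdisj
  set p : Fin m → ℝ := fun r => f (Pi.single r 1) with hp
  have hf : ∀ x : Fin m → ℝ, f x = ∑ r, p r * x r := by
    intro x
    conv_lhs => rw [pi_eq_sum_univ' x]
    rw [map_sum]
    refine Finset.sum_congr rfl fun r _ => ?_
    rw [map_smul, smul_eq_mul, mul_comm]
  have hconst : ∀ c : ℝ, f (fun _ => c) = (∑ r, p r) * c := fun c => by
    rw [hf, Finset.sum_mul]
  have hc : ∀ c < L, (∑ r, p r) * c < u := fun c h => by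
    rw [← hconst]; exact hf1 _ fun _ _ => h
  have hp0 : ∀ r, 0 ≤ p r := by
    intro r
    by_contra! hneg
    have h0 := hc (L - 1) (by linarith)
    set t := (u - (∑ r, p r) * (L - 1)) / (- p r) with ht
    have htpos : 0 ≤ t := div_nonneg (by linarith) (by linarith)
    have h1 := hf1 ((fun _ => L - 1) - t • Pi.single r 1) (by
      intro i _
      have : (0 : ℝ) ≤ (Pi.single r 1 : Fin m → ℝ) i := by
        rw [Pi.single_apply]; split_ifs <;> norm_num
      have := mul_nonneg htpos this
      simp only [Pi.sub_apply, Pi.smul_apply, smul_eq_mul, Set.mem_Iio]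
      linarith)
    rw [map_sub, map_smul, hconst, smul_eq_mul] at h1
    have h2 : t * (- p r) = u - (∑ r, p r) * (L - 1) :=
      div_mul_cancel₀ _ (by linarith)
    have h3 : f (Pi.single r 1) = p r := rfl
    rw [h3] at h1
    linarith
  have hP : 0 < ∑ r, p r := by
    refine lt_of_le_of_ne (Finset.sum_nonneg fun r _ => hp0 r) fun h => ?_
    have hz : ∀ r, p r = 0 := fun r =>
      (Finset.sum_eq_zero_iff_of_nonneg fun r _ => hp0 r).1 h.symm r (Finset.mem_univ r)
    obtain ⟨x, hx⟩ := hne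
    have h1 := hf2 x hx
    have h2 := hc (L - 1) (by linarith)
    rw [hf] at h1
    simp only [hz, zero_mul, Finset.sum_const_zero] at h1 h2
    linarith
  have hLu : L ≤ u / ∑ r, p r := by
    refine le_of_forall_lt fun c h => ?_
    rw [lt_div_iff₀ hP, mul_comm]
    exact hc c h
  have hq : (∀ r, 0 ≤ p r / (∑ r, p r) ∧ p r / (∑ r, p r) ≤ 1) ∧
      ∑ r, p r / (∑ r, p r) = 1 := by
    refine ⟨fun r => ⟨div_nonneg (hp0 r) hP.le, ?_⟩, ?_⟩
    · rw [div_le_one hP]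
      exact Finset.single_le_sum (fun i _ => hp0 i) (Finset.mem_univ r)
    · rw [← Finset.sum_div, div_self hP.ne']
  refine le_trans ?_ (le_ciSup (f := fun p : {p : Fin m → ℝ // (∀ r, 0 ≤ p r ∧ p r ≤ 1) ∧
      ∑ r, p r = 1} => ⨅ x : 𝒳, ∑ r, (p : Fin m → ℝ) r * (x : Fin m → ℝ) r)
    ⟨L, by rintro _ ⟨p, rfl⟩; exact hweak p⟩ ⟨fun r => p r / ∑ r, p r, hq⟩)
  refine le_ciInf fun x => hLu.trans ?_
  have h1 := hf2 x x.2
  rw [hf] at h1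
  calc u / ∑ r, p r ≤ (∑ r, p r * (x : Fin m → ℝ) r) / ∑ r, p r :=
        div_le_div_of_nonneg_right h1 hP.le
    _ = _ := by
        rw [Finset.sum_div]
        exact Finset.sum_congr rfl fun r _ => by ring
end

section
/- For each C in a finite set 𝒞, let B_C be a nonempty convex subset of a real vector space and let g^{(C)} : B_C → ℝ^m_{≥0} be a map each of whose coordinate functions g^{(C)}_r : B_C → ℝ_{≥0} (r = 1,…,m) is convex. Set X_C := conv(g^{(C)}(B_C)), 𝒳 := ∑_{C∈𝒞} X_C and 𝒢 := ∑_{C∈𝒞} g^{(C)}(B_C) (Minkowski sums). Then: (i) for every y ∈ ℝ^m_{≥0} and every C ∈ 𝒞, inf_{x ∈ g^{(C)}(B_C)} ⟨y, x⟩ = inf_{x ∈ X_C} ⟨y, x⟩; and (ii) inf_{x ∈ 𝒳} ‖x‖_∞ = inf_{g ∈ 𝒢} ‖g‖_∞. -/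
open scoped BigOperators

theorem aux_iInf_eq {α : Type*} (S T : Set α) (f : α → ℝ) (hST : S ⊆ T) (hS : S.Nonempty)
    (hf : ∀ t ∈ T, 0 ≤ f t) (hd : ∀ t ∈ T, ∃ s ∈ S, f s ≤ f t) :
    (⨅ x : S, f x) = ⨅ x : T, f x := by
  have : Nonempty S := hS.to_subtype
  have : Nonempty T := (hS.mono hST).to_subtype
  have bS : BddBelow (Set.range fun x : S => f x) :=
    ⟨0, by rintro _ ⟨x, rfl⟩; exact hf _ (hST x.2)⟩
  have bT : BddBelow (Set.range fun x : T => f x) :=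
    ⟨0, by rintro _ ⟨x, rfl⟩; exact hf _ x.2⟩
  apply le_antisymm
  · refine le_ciInf fun t => ?_
    obtain ⟨s, hs, hst⟩ := hd t t.2
    exact (ciInf_le bS ⟨s, hs⟩).trans hst
  · exact le_ciInf fun s => ciInf_le bT ⟨s, hST s.2⟩

theorem aux_dom {m : ℕ} {V : Type*} [AddCommGroup V] [Module ℝ V] (B : Set V)
    (hB : Convex ℝ B) (g : V → Fin m → ℝ) (hg : ∀ r, ConvexOn ℝ B (fun v => g v r))
    (x : Fin m → ℝ) (hx : x ∈ convexHull ℝ (g '' B)) : ∃ v ∈ B, ∀ r, g v r ≤ x r := by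
  have hc : Convex ℝ {x : Fin m → ℝ | ∃ v ∈ B, ∀ r, g v r ≤ x r} := by
    rintro x ⟨v, hv, hvx⟩ y ⟨w, hw, hwy⟩ a b ha hb hab
    refine ⟨a • v + b • w, hB hv hw ha hb hab, fun r => ?_⟩
    have h := (hg r).2 hv hw ha hb hab
    simp only [smul_eq_mul] at h
    have h1 := mul_le_mul_of_nonneg_left (hvx r) ha
    have h2 := mul_le_mul_of_nonneg_left (hwy r) hb
    simp only [Pi.add_apply, Pi.smul_apply, smul_eq_mul]
    linarith
  refine convexHull_min ?_ hc hx
  rintro _ ⟨v, hv, rfl⟩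
  exact ⟨v, hv, fun r => le_rfl⟩

/-- Passing from the images `g^{(C)}(B_C)` to their convex hulls
`X_C = conv(g^{(C)}(B_C))` changes neither the optimal value of linear minimization over
a single block (for nonnegative prices), nor the optimal value `inf ‖·‖_∞` over the
Minkowski sums. -/
theorem stmt_1 (m : ℕ) (hm : 1 ≤ m)
    (𝒞 : Type) [Fintype 𝒞] [Nonempty 𝒞]
    (V : Type) [AddCommGroup V] [Module ℝ V]
    (B : 𝒞 → Set V) (hBne : ∀ c, (B c).Nonempty) (hBcv : ∀ c, Convex ℝ (B c))
    (g : 𝒞 → V → (Fin m → ℝ))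
    (hgconv : ∀ c r, ConvexOn ℝ (B c) (fun v => g c v r))
    (hgpos : ∀ c, ∀ v ∈ B c, ∀ r, 0 ≤ g c v r)
    (X : 𝒞 → Set (Fin m → ℝ)) (hX : ∀ c, X c = convexHull ℝ (g c '' B c))
    (𝒳 𝒢 : Set (Fin m → ℝ))
    (h𝒳 : 𝒳 = {x | ∃ u : 𝒞 → Fin m → ℝ, (∀ c, u c ∈ X c) ∧ x = ∑ c, u c})
    (h𝒢 : 𝒢 = {x | ∃ u : 𝒞 → Fin m → ℝ, (∀ c, u c ∈ g c '' B c) ∧ x = ∑ c, u c}) :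
    (∀ y : Fin m → ℝ, (∀ r, 0 ≤ y r) → ∀ c,
        (⨅ x : (g c '' B c : Set (Fin m → ℝ)), ∑ r, y r * (x : Fin m → ℝ) r)
          = ⨅ x : X c, ∑ r, y r * (x : Fin m → ℝ) r) ∧
      (⨅ x : 𝒳, ‖(x : Fin m → ℝ)‖) = ⨅ x : 𝒢, ‖(x : Fin m → ℝ)‖ := by
  have hdom : ∀ c, ∀ x ∈ X c, ∃ v ∈ B c, ∀ r, g c v r ≤ x r := fun c x hx =>
    aux_dom (B c) (hBcv c) (g c) (hgconv c) x (hX c ▸ hx)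
  have hsub : ∀ c, g c '' B c ⊆ X c := fun c => by
    rw [hX c]; exact subset_convexHull ℝ _
  refine ⟨fun y hy c => ?_, ?_⟩
  · refine aux_iInf_eq (g c '' B c) (X c) (fun x => ∑ r, y r * x r) (hsub c)
      ((hBne c).image _) ?_ ?_
    · intro t ht
      obtain ⟨v, hv, h⟩ := hdom c t ht
      exact Finset.sum_nonneg fun r _ => mul_nonneg (hy r) ((hgpos c v hv r).trans (h r))
    · intro t ht
      obtain ⟨v, hv, h⟩ := hdom c t ht
      exact ⟨g c v, ⟨v, hv, rfl⟩,
        Finset.sum_le_sum fun r _ => mul_le_mul_of_nonneg_left (h r) (hy r)⟩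
  · symm
    refine aux_iInf_eq 𝒢 𝒳 (fun x => ‖x‖) ?_ ?_ (fun _ _ => norm_nonneg _) ?_
    · rw [h𝒢, h𝒳]
      rintro x ⟨u, hu, rfl⟩
      exact ⟨u, fun c => hsub c (hu c), rfl⟩
    · choose v hv using hBne
      rw [h𝒢]
      exact ⟨_, fun c => g c (v c), fun c => ⟨v c, hv c, rfl⟩, rfl⟩
    · rw [h𝒢, h𝒳]
      rintro x ⟨u, hu, rfl⟩
      choose v hv hvu using fun c => hdom c (u c) (hu c)
      refine ⟨_, ⟨fun c => g c (v c), fun c => ⟨v c, hv c, rfl⟩, rfl⟩, ?_⟩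
      refine (pi_norm_le_iff_of_nonneg (norm_nonneg _)).2 fun r => ?_
      refine le_trans ?_ (norm_le_pi_norm _ r)
      simp only [Finset.sum_apply, Real.norm_eq_abs]
      rw [abs_of_nonneg (Finset.sum_nonneg fun c _ => hgpos c _ (hv c) r)]
      exact (Finset.sum_le_sum fun c _ => hvu c r).trans (le_abs_self _)
end

section
/- Let an instance of the block-angular min-max resource sharing problem with a σ-approximate block solver be given, and let x := ∑_{C∈𝒞} f_C(𝟙) ∈ 𝒳, where 𝟙 ∈ ℝ^ℛ is the all-ones vector. Then λ* ≤ ‖x‖_∞ ≤ ‖x‖_1 ≤ σ m λ*, where m = |ℛ|. -/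
open scoped BigOperators

/-- For `x := ∑_{C∈𝒞} f_C(𝟙) ∈ 𝒳` one has the sandwich inequality
`λ* ≤ ‖x‖_∞ ≤ ‖x‖_1 ≤ σ m λ*`. -/
theorem stmt_3 (m : ℕ) (hm : 1 ≤ m)
    (𝒞 : Type) [Fintype 𝒞] [Nonempty 𝒞]
    (X : 𝒞 → Set (Fin m → ℝ))
    (hXne : ∀ c, (X c).Nonempty) (hXcl : ∀ c, IsClosed (X c))
    (hXcv : ∀ c, Convex ℝ (X c))
    (hXpos : ∀ c, ∀ x ∈ X c, ∀ r, 0 ≤ x r)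
    (𝒳 : Set (Fin m → ℝ))
    (h𝒳 : 𝒳 = {x | ∃ g : 𝒞 → Fin m → ℝ, (∀ c, g c ∈ X c) ∧ x = ∑ c, g c})
    (lam : ℝ) (hlam : lam = ⨅ x : 𝒳, ‖(x : Fin m → ℝ)‖)
    (σ : ℝ) (hσ : 1 ≤ σ)
    (f : 𝒞 → (Fin m → ℝ) → (Fin m → ℝ))
    (hfmem : ∀ c y, (∀ r, 0 ≤ y r) → f c y ∈ X c)
    (hfapx : ∀ c y, (∀ r, 0 ≤ y r) →
      ∑ r, y r * f c y r ≤ σ * ⨅ x : X c, ∑ r, y r * (x : Fin m → ℝ) r)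
    (x : Fin m → ℝ) (hx : x = ∑ c, f c (fun _ => 1)) :
    lam ≤ ‖x‖ ∧ ‖x‖ ≤ ∑ r, |x r| ∧ ∑ r, |x r| ≤ σ * m * lam := by
  have hmem : x ∈ 𝒳 := by
    rw [h𝒳]
    exact ⟨fun c => f c (fun _ => 1), fun c => hfmem c _ (fun _ => zero_le_one), hx⟩
  have hσ0 : 0 < σ := by linarith
  have hm0 : (0 : ℝ) < m := by exact_mod_cast hm
  have key : ∀ z ∈ 𝒳, ∑ r, |x r| ≤ σ * m * ‖z‖ := by
    intro z hz
    rw [h𝒳] at hz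
    obtain ⟨g, hg, rfl⟩ := hz
    have h1 : ∀ c, ∑ r, f c (fun _ => 1) r ≤ σ * ∑ r, g c r := by
      intro c
      have h := hfapx c (fun _ => 1) (fun _ => zero_le_one)
      simp only [one_mul] at h
      refine h.trans (mul_le_mul_of_nonneg_left ?_ hσ0.le)
      refine ciInf_le (f := fun x : X c => ∑ r, (x : Fin m → ℝ) r) ⟨0, ?_⟩ ⟨g c, hg c⟩
      rintro _ ⟨y, rfl⟩
      exact Finset.sum_nonneg fun r _ => hXpos c _ y.2 r
    have hxabs : ∑ r, |x r| = ∑ c, ∑ r, f c (fun _ => 1) r := by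
      rw [Finset.sum_comm]
      refine Finset.sum_congr rfl fun r _ => ?_
      rw [hx, Finset.sum_apply, abs_of_nonneg]
      exact Finset.sum_nonneg fun c _ => hXpos c _ (hfmem c _ (fun _ => zero_le_one)) r
    have h2 : ∑ c, ∑ r, g c r ≤ m * ‖∑ c, g c‖ := by
      rw [Finset.sum_comm]
      calc ∑ r, ∑ c, g c r ≤ ∑ _r : Fin m, ‖∑ c, g c‖ := by
            refine Finset.sum_le_sum fun r _ => ?_
            have h := norm_le_pi_norm (∑ c, g c) r
            rw [Finset.sum_apply, Real.norm_eq_abs] at h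
            exact (le_abs_self _).trans h
        _ = m * ‖∑ c, g c‖ := by simp
    calc ∑ r, |x r| = ∑ c, ∑ r, f c (fun _ => 1) r := hxabs
      _ ≤ ∑ c, σ * ∑ r, g c r := Finset.sum_le_sum fun c _ => h1 c
      _ = σ * ∑ c, ∑ r, g c r := by rw [Finset.mul_sum]
      _ ≤ σ * (m * ‖∑ c, g c‖) := mul_le_mul_of_nonneg_left h2 hσ0.le
      _ = σ * m * ‖∑ c, g c‖ := by ring
  refine ⟨?_, ?_, ?_⟩
  · rw [hlam]
    refine ciInf_le (f := fun x : 𝒳 => ‖(x : Fin m → ℝ)‖) ⟨0, ?_⟩ ⟨x, hmem⟩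
    rintro _ ⟨y, rfl⟩
    exact norm_nonneg _
  · refine (pi_norm_le_iff_of_nonneg (Finset.sum_nonneg fun r _ => abs_nonneg _)).2 fun r => ?_
    exact Finset.single_le_sum (f := fun r => |x r|) (fun r _ => abs_nonneg _) (Finset.mem_univ r)
  · have : Nonempty 𝒳 := ⟨⟨x, hmem⟩⟩
    have hp : 0 < σ * m := mul_pos hσ0 hm0
    rw [← div_le_iff₀' hp, hlam]
    refine le_ciInf fun z => ?_
    rw [div_le_iff₀' hp]
    exact key z z.2
end

section
/- Let an instance of the block-angular min-max resource sharing problem with a σ-approximate block solver be given that satisfies local weak duality with respect to S ⊆ ℛ and μ ≥ 0. Let ε > 0 and η := e^ε − 1, and assume η μ < 1. Let k ∈ ℕ, let C_1,…,C_k ∈ 𝒞 and ξ_1,…,ξ_k ≥ 0 satisfy ∑_{j : C_j = C} ξ_j ≤ 1 for every C ∈ 𝒞. Let y^{(0)} ∈ ℝ^ℛ_{≥0} and define recursively y^{(j)}_r := y^{(j−1)}_r · exp(ε ξ_j b^{(j)}_r) for all r ∈ ℛ, where b^{(j)} := f_{C_j}(y^{(j−1)}), and assume ξ_j · ‖b^{(j)}‖_∞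 ≤ 1 for all j = 1,…,k. Then ∑_{r∈S} y^{(k)}_r ≤ (1/(1 − η μ)) · ∑_{r∈S} y^{(0)}_r. -/
open scoped BigOperators

/-- (Price increase within one phase.)  Under local weak duality w.r.t.
`S` and `μ`, with `η := e^ε − 1` and `η μ < 1`, a sequence of multiplicative price updates
whose step sizes sum to at most `1` per customer and satisfy `ξ_j ‖b^{(j)}‖_∞ ≤ 1` increases
`∑_{r∈S} y_r` by at most the factor `1/(1 − η μ)`. -/
theorem stmt_4 (m : ℕ) (hm : 1 ≤ m)
    (𝒞 : Type) [Fintype 𝒞] [Nonempty 𝒞] [DecidableEq 𝒞]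
    (X : 𝒞 → Set (Fin m → ℝ))
    (hXne : ∀ c, (X c).Nonempty) (hXcl : ∀ c, IsClosed (X c))
    (hXcv : ∀ c, Convex ℝ (X c))
    (hXpos : ∀ c, ∀ x ∈ X c, ∀ r, 0 ≤ x r)
    (σ : ℝ) (hσ : 1 ≤ σ)
    (f : 𝒞 → (Fin m → ℝ) → (Fin m → ℝ))
    (hfmem : ∀ c y, (∀ r, 0 ≤ y r) → f c y ∈ X c)
    (hfapx : ∀ c y, (∀ r, 0 ≤ y r) →
      ∑ r, y r * f c y r ≤ σ * ⨅ x : X c, ∑ r, y r * (x : Fin m → ℝ) r)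
    -- local weak duality w.r.t. `S` and `μ`
    (S : Finset (Fin m)) (μ : ℝ) (hμ : 0 ≤ μ)
    (hLWD : ∀ y : 𝒞 → Fin m → ℝ, (∀ c r, 0 ≤ y c r) →
      ∑ c, ∑ r ∈ S, y c r * f c (y c) r ≤ μ * ∑ r ∈ S, ⨆ c, y c r)
    -- parameters
    (ε : ℝ) (hε : 0 < ε) (η : ℝ) (hη : η = Real.exp ε - 1) (hημ : η * μ < 1)
    -- the sequence of oracle calls
    (k : ℕ) (Cu : Fin k → 𝒞) (ξ : Fin k → ℝ) (hξ0 : ∀ j, 0 ≤ ξ j)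
    (hξsum : ∀ c, ∑ j ∈ Finset.univ.filter (fun j => Cu j = c), ξ j ≤ 1)
    (y : ℕ → Fin m → ℝ) (hy0 : ∀ r, 0 ≤ y 0 r)
    (b : Fin k → Fin m → ℝ) (hb : ∀ j, b j = f (Cu j) (y j.1))
    (hysucc : ∀ j : Fin k, y (j.1 + 1) = fun r => y j.1 r * Real.exp (ε * ξ j * b j r))
    (hstep : ∀ j, ξ j * ‖b j‖ ≤ 1) :
    ∑ r ∈ S, y k r ≤ (1 / (1 - η * μ)) * ∑ r ∈ S, y 0 r := by
  have hconv : ∀ t : ℝ, 0 ≤ t → t ≤ 1 → Real.exp (ε * t) ≤ 1 + η * t := by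
    intro t h0 h1
    have h := convexOn_exp.2 (Set.mem_univ (0 : ℝ)) (Set.mem_univ ε)
      (sub_nonneg.2 h1) h0 (by ring)
    simp only [smul_eq_mul, mul_zero, zero_add, Real.exp_zero, mul_one] at h
    rw [mul_comm ε t, hη]
    linarith
  have hη0 : 0 ≤ η := by
    have := Real.add_one_le_exp ε
    linarith
  have hnn : ∀ n, n ≤ k → ∀ r, 0 ≤ y n r := by
    intro n
    induction n with
    | zero => intro _ r; exact hy0 r
    | succ n ih =>
      intro hn r
      rw [hysucc ⟨n, hn⟩]
      exact mul_nonneg (ih (by omega) r) (Real.exp_pos _).le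
  have hfnn : ∀ c n, n ≤ k → ∀ r, 0 ≤ f c (y n) r := fun c n hn r =>
    hXpos c _ (hfmem c _ (hnn n hn)) r
  have hbnn : ∀ j r, 0 ≤ b j r := fun j r => by
    rw [hb]; exact hfnn _ _ j.2.le r
  have hmono : ∀ d n, n + d ≤ k → ∀ r, y n r ≤ y (n + d) r := by
    intro d
    induction d with
    | zero => intro n _ r; exact le_rfl
    | succ d ih =>
      intro n hn r
      refine (ih n (by omega) r).trans ?_
      have h2 := congrFun (hysucc ⟨n + d, by omega⟩) r
      simp only at h2
      rw [← add_assoc, h2]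
      refine le_mul_of_one_le_right (hnn _ (by omega) r) (Real.one_le_exp ?_)
      exact mul_nonneg (mul_nonneg hε.le (hξ0 _)) (hbnn _ _)
  have hle : ∀ n, n ≤ k → ∀ r, y n r ≤ y k r := by
    intro n hn r
    have h := hmono (k - n) n (by omega) r
    rwa [Nat.add_sub_cancel' hn] at h
  let G : 𝒞 → ℕ → ℝ := fun c n => ∑ r ∈ S, y n r * f c (y n) r
  have hG0 : ∀ c n, n ≤ k → 0 ≤ G c n := fun c n hn =>
    Finset.sum_nonneg fun r _ => mul_nonneg (hnn n hn r) (hfnn c n hn r)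
  have hmax : ∀ c, ∃ i, i ≤ k ∧ ∀ n, n ≤ k → G c n ≤ G c i := by
    intro c
    obtain ⟨i, hi, h⟩ := Finset.exists_max_image (Finset.range (k + 1)) (G c) ⟨0, by simp⟩
    exact ⟨i, by simpa [Nat.lt_succ_iff] using hi, fun n hn => h n (by simp; omega)⟩
  choose i hik himax using hmax
  have hstep1 : ∀ j : Fin k, (∑ r ∈ S, y (j.1 + 1) r) - ∑ r ∈ S, y j.1 r
      ≤ η * (ξ j * G (Cu j) j.1) := by
    intro j
    rw [← Finset.sum_sub_distrib]
    simp only [G, Finset.mul_sum]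
    refine Finset.sum_le_sum fun r _ => ?_
    rw [hysucc j, ← hb j]
    have h1 : ξ j * b j r ≤ 1 := by
      refine le_trans (mul_le_mul_of_nonneg_left ?_ (hξ0 j)) (hstep j)
      exact (le_abs_self _).trans (norm_le_pi_norm (b j) r)
    have h2 := hconv _ (mul_nonneg (hξ0 j) (hbnn j r)) h1
    have h3 := mul_le_mul_of_nonneg_left h2 (hnn j.1 j.2.le r)
    rw [← mul_assoc ε] at h3
    linarith
  have htel : (∑ r ∈ S, y k r) - ∑ r ∈ S, y 0 r ≤ η * ∑ j : Fin k, ξ j * G (Cu j) j.1 := by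
    rw [← Finset.sum_range_sub (fun n => ∑ r ∈ S, y n r) k,
      ← Fin.sum_univ_eq_sum_range (fun n => (∑ r ∈ S, y (n + 1) r) - ∑ r ∈ S, y n r) k,
      Finset.mul_sum]
    exact Finset.sum_le_sum fun j _ => hstep1 j
  have hcust : ∑ j : Fin k, ξ j * G (Cu j) j.1 ≤ ∑ c, G c (i c) := by
    rw [← Finset.sum_fiberwise Finset.univ Cu]
    refine Finset.sum_le_sum fun c _ => ?_
    calc ∑ j ∈ Finset.univ.filter (fun j => Cu j = c), ξ j * G (Cu j) j.1
        ≤ ∑ j ∈ Finset.univ.filter (fun j => Cu j = c), ξ j * G c (i c) := by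
          refine Finset.sum_le_sum fun j hj => ?_
          rw [(Finset.mem_filter.1 hj).2]
          exact mul_le_mul_of_nonneg_left (himax c _ j.2.le) (hξ0 j)
      _ = (∑ j ∈ Finset.univ.filter (fun j => Cu j = c), ξ j) * G c (i c) := by
          rw [Finset.sum_mul]
      _ ≤ 1 * G c (i c) := mul_le_mul_of_nonneg_right (hξsum c) (hG0 c _ (hik c))
      _ = G c (i c) := one_mul _
  have hdual : ∑ c, G c (i c) ≤ μ * ∑ r ∈ S, y k r := by
    refine (hLWD (fun c => y (i c)) fun c r => hnn _ (hik c) r).trans ?_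
    refine mul_le_mul_of_nonneg_left (Finset.sum_le_sum fun r _ => ?_) hμ
    exact ciSup_le fun c => hle _ (hik c) r
  have hfin := mul_le_mul_of_nonneg_left (hcust.trans hdual) hη0
  rw [one_div, ← div_eq_inv_mul, le_div_iff₀ (by linarith)]
  linarith
end

section
/- Let an instance of the block-angular min-max resource sharing problem with a σ-approximate block solver be given that satisfies local weak duality with respect to S ⊆ ℛ and μ ≥ 0, and let η := e^ε − 1 with η μ < 1. Then in any run of the core algorithm with parameters ε > 0 and T phases, the end-of-phase price vectors satisfy, for all t = 0, 1, …, T: ∑_{r∈S} y^{(t)}_r ≤ |S| · exp( t η μ / (1 − η μ) ). -/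
open scoped BigOperators

/-- (Upper bound on the price increase.)  If the instance satisfies local
weak duality w.r.t. `S` and `μ` and `η μ < 1` with `η := e^ε − 1`, then in any run of the
core algorithm the end-of-phase prices satisfy
`∑_{r∈S} y^{(t)}_r ≤ |S| · exp(t η μ / (1 − η μ))` for all `t = 0,1,…,T`. -/
theorem stmt_5 (m : ℕ) (hm : 1 ≤ m)
    (𝒞 : Type) [Fintype 𝒞] [Nonempty 𝒞] [DecidableEq 𝒞]
    (X : 𝒞 → Set (Fin m → ℝ))
    (hXne : ∀ c, (X c).Nonempty) (hXcl : ∀ c, IsClosed (X c))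
    (hXcv : ∀ c, Convex ℝ (X c))
    (hXpos : ∀ c, ∀ x ∈ X c, ∀ r, 0 ≤ x r)
    (σ : ℝ) (hσ : 1 ≤ σ)
    (f : 𝒞 → (Fin m → ℝ) → (Fin m → ℝ))
    (hfmem : ∀ c y, (∀ r, 0 ≤ y r) → f c y ∈ X c)
    (hfapx : ∀ c y, (∀ r, 0 ≤ y r) →
      ∑ r, y r * f c y r ≤ σ * ⨅ x : X c, ∑ r, y r * (x : Fin m → ℝ) r)
    -- local weak duality w.r.t. `S` and `μ`
    (S : Finset (Fin m)) (μ : ℝ) (hμ : 0 ≤ μ)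
    (hLWD : ∀ y : 𝒞 → Fin m → ℝ, (∀ c r, 0 ≤ y c r) →
      ∑ c, ∑ r ∈ S, y c r * f c (y c) r ≤ μ * ∑ r ∈ S, ⨆ c, y c r)
    (ε : ℝ) (hε : 0 < ε) (η : ℝ) (hη : η = Real.exp ε - 1) (hημ : η * μ < 1)
    -- a run of the core algorithm with parameters ε and T
    (T : ℕ) (N : ℕ) (p : Fin N → ℕ) (Cu : Fin N → 𝒞) (ξ : Fin N → ℝ)
    (hp : ∀ j, 1 ≤ p j ∧ p j ≤ T)
    (hpmono : ∀ j k : Fin N, j ≤ k → p j ≤ p k)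
    (hξ0 : ∀ j, 0 ≤ ξ j)
    (w : ℕ → Fin m → ℝ) (hw0 : w 0 = fun _ => 1)
    (b : Fin N → Fin m → ℝ) (hb : ∀ j, b j = f (Cu j) (w j.1))
    (hwsucc : ∀ j : Fin N, w (j.1 + 1) = fun r => w j.1 r * Real.exp (ε * ξ j * b j r))
    (hstep : ∀ j, ξ j * ‖b j‖ ≤ 1)
    (hphase : ∀ t, 1 ≤ t → t ≤ T → ∀ c,
      ∑ j ∈ Finset.univ.filter (fun j => p j = t ∧ Cu j = c), ξ j = 1)
    (y : ℕ → Fin m → ℝ)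
    (hy : ∀ t, y t = w (Finset.univ.filter (fun j : Fin N => p j ≤ t)).card) :
    ∀ t ≤ T, ∑ r ∈ S, y t r ≤ (S.card : ℝ) * Real.exp (t * (η * μ) / (1 - η * μ)) := by
  classical
  have hη0 : 0 ≤ η := by
    rw [hη]; linarith [Real.add_one_le_exp ε]
  -- phase boundaries
  have hcard : ∀ t (j : Fin N),
      p j ≤ t ↔ j.1 < (Finset.univ.filter (fun j : Fin N => p j ≤ t)).card := by
    intro t j
    constructor
    · intro h
      have h1 : Finset.Iic j ⊆ Finset.univ.filter (fun j : Fin N => p j ≤ t) := by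
        intro k hk
        simp only [Finset.mem_Iic] at hk
        simp only [Finset.mem_filter, Finset.mem_univ, true_and]
        exact (hpmono k j hk).trans h
      have h2 := Finset.card_le_card h1
      rw [Fin.card_Iic] at h2
      omega
    · intro h
      by_contra hn
      have h1 : Finset.univ.filter (fun j : Fin N => p j ≤ t) ⊆ Finset.Iio j := by
        intro k hk
        simp only [Finset.mem_filter, Finset.mem_univ, true_and] at hk
        simp only [Finset.mem_Iio]
        by_contra hjk
        exact hn ((hpmono j k (not_lt.mp hjk)).trans hk)
      have h2 := Finset.card_le_card h1
      rw [Fin.card_Iio] at h2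
      omega
  have hcardN : ∀ t, (Finset.univ.filter (fun j : Fin N => p j ≤ t)).card ≤ N := by
    intro t
    have := Finset.card_le_univ (Finset.univ.filter (fun j : Fin N => p j ≤ t))
    simpa using this
  have hwpos : ∀ k, k ≤ N → ∀ r, 0 < w k r := by
    intro k
    induction k with
    | zero => intro _ r; simp [hw0]
    | succ k ih =>
      intro hk r
      have h := hwsucc ⟨k, hk⟩
      simp only at h
      rw [h]
      exact mul_pos (ih (by omega) r) (Real.exp_pos _)
  have hb0 : ∀ j r, 0 ≤ b j r := by
    intro j r
    rw [hb j]
    exact hXpos _ _ (hfmem _ _ (fun r => (hwpos _ j.2.le r).le)) r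
  have hwmono : ∀ k d, k + d ≤ N → ∀ r, w k r ≤ w (k + d) r := by
    intro k d
    induction d with
    | zero => intro _ r; simp
    | succ d ih =>
      intro hk r
      refine (ih (by omega) r).trans ?_
      have h := hwsucc ⟨k + d, by omega⟩
      simp only at h
      rw [← add_assoc, h]
      refine le_mul_of_one_le_right (hwpos _ (by omega) r).le (Real.one_le_exp ?_)
      exact mul_nonneg (mul_nonneg hε.le (hξ0 _)) (hb0 _ _)
  -- single step
  have hone : ∀ (j : Fin N) r, w (j.1 + 1) r - w j.1 r ≤ η * (ξ j * (w j.1 r * b j r)) := by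
    intro j r
    rw [hwsucc j]
    have hx0 : 0 ≤ ξ j * b j r := mul_nonneg (hξ0 j) (hb0 j r)
    have hx1 : ξ j * b j r ≤ 1 := by
      refine le_trans (mul_le_mul_of_nonneg_left ?_ (hξ0 j)) (hstep j)
      exact (le_abs_self _).trans (norm_le_pi_norm (b j) r)
    have hc := convexOn_exp.2 (Set.mem_univ (0 : ℝ)) (Set.mem_univ ε)
      (sub_nonneg.mpr hx1) hx0 (by ring)
    simp only [smul_eq_mul, mul_zero, zero_add, Real.exp_zero, mul_one] at hc
    have he : ε * ξ j * b j r = ξ j * b j r * ε := by ring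
    beta_reduce
    rw [he]
    have h2 : Real.exp (ξ j * b j r * ε) - 1 ≤ η * (ξ j * b j r) := by
      rw [hη]; linarith
    have h3 := mul_le_mul_of_nonneg_left h2 (hwpos _ j.2.le r).le
    linarith
  -- telescoping
  have htel : ∀ k, k ≤ N → ∀ r,
      w k r = 1 + ∑ j ∈ Finset.univ.filter (fun j : Fin N => j.1 < k),
        (w (j.1 + 1) r - w j.1 r) := by
    intro k
    induction k with
    | zero => intro _ r; simp [hw0]
    | succ k ih =>
      intro hk r
      have hins : Finset.univ.filter (fun j : Fin N => j.1 < k + 1)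
          = insert (⟨k, hk⟩ : Fin N) (Finset.univ.filter (fun j : Fin N => j.1 < k)) := by
        ext j
        simp only [Finset.mem_filter, Finset.mem_univ, true_and, Finset.mem_insert, Fin.ext_iff]
        omega
      rw [hins, Finset.sum_insert (by simp)]
      have := ih (by omega) r
      simp only
      linarith
  have hytel : ∀ t r, y t r = 1 + ∑ j ∈ Finset.univ.filter (fun j : Fin N => p j ≤ t),
        (w (j.1 + 1) r - w j.1 r) := by
    intro t r
    rw [hy t, htel _ (hcardN t) r]
    congr 1
    refine Finset.sum_congr ?_ (fun _ _ => rfl)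
    ext j
    simp only [Finset.mem_filter, Finset.mem_univ, true_and]
    exact (hcard t j).symm
  have hydiff : ∀ t r, y (t + 1) r - y t r
      = ∑ j ∈ Finset.univ.filter (fun j : Fin N => p j = t + 1),
        (w (j.1 + 1) r - w j.1 r) := by
    intro t r
    rw [hytel, hytel]
    have hu : Finset.univ.filter (fun j : Fin N => p j ≤ t + 1)
        = Finset.univ.filter (fun j : Fin N => p j ≤ t)
          ∪ Finset.univ.filter (fun j : Fin N => p j = t + 1) := by
      ext j
      simp only [Finset.mem_filter, Finset.mem_univ, true_and, Finset.mem_union]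
      omega
    rw [hu, Finset.sum_union]
    · ring
    · rw [Finset.disjoint_left]
      intro j h1 h2
      simp only [Finset.mem_filter, Finset.mem_univ, true_and] at h1 h2
      omega
  -- one phase
  have hphase1 : ∀ t, t + 1 ≤ T →
      ∑ r ∈ S, y (t + 1) r - ∑ r ∈ S, y t r ≤ η * (μ * ∑ r ∈ S, y (t + 1) r) := by
    intro t ht
    set Q : Fin N → ℝ := fun j => ∑ r ∈ S, w j.1 r * b j r with hQ
    have hsel : ∀ c, ∃ j : Fin N, (p j = t + 1 ∧ Cu j = c) ∧
        ∀ k : Fin N, p k = t + 1 ∧ Cu k = c → Q k ≤ Q j := by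
      intro c
      have hne : (Finset.univ.filter (fun j => p j = t + 1 ∧ Cu j = c)).Nonempty := by
        by_contra h
        rw [Finset.not_nonempty_iff_eq_empty] at h
        have := hphase (t + 1) (by omega) ht c
        rw [h] at this
        simp at this
      obtain ⟨j, hj, hmax⟩ := Finset.exists_max_image _ Q hne
      refine ⟨j, by simpa using hj, fun k hk => hmax k (by simpa using hk)⟩
    choose J hJ hJmax using hsel
    have h1 : ∑ r ∈ S, y (t + 1) r - ∑ r ∈ S, y t r
        ≤ η * ∑ j ∈ Finset.univ.filter (fun j : Fin N => p j = t + 1), ξ j * Q j := by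
      rw [← Finset.sum_sub_distrib]
      simp only [hydiff]
      rw [Finset.sum_comm, Finset.mul_sum]
      refine Finset.sum_le_sum fun j _ => ?_
      rw [hQ]
      simp only [Finset.mul_sum]
      exact Finset.sum_le_sum fun r _ => hone j r
    have h2 : ∑ j ∈ Finset.univ.filter (fun j : Fin N => p j = t + 1), ξ j * Q j
        ≤ ∑ c, Q (J c) := by
      rw [← Finset.sum_fiberwise _ Cu]
      refine Finset.sum_le_sum fun c _ => ?_
      rw [Finset.filter_filter]
      calc _ ≤ ∑ j ∈ Finset.univ.filter (fun j => p j = t + 1 ∧ Cu j = c), ξ j * Q (J c) := by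
            refine Finset.sum_le_sum fun j hj => ?_
            exact mul_le_mul_of_nonneg_left (hJmax c j (by simpa using hj)) (hξ0 j)
        _ = Q (J c) := by
            rw [← Finset.sum_mul, hphase (t + 1) (by omega) ht c, one_mul]
    have h3 : ∑ c, Q (J c) ≤ μ * ∑ r ∈ S, y (t + 1) r := by
      have h := hLWD (fun c => w (J c).1) (fun c r => (hwpos _ (J c).2.le r).le)
      have he : ∑ c, Q (J c) = ∑ c, ∑ r ∈ S, w (J c).1 r * f c (w (J c).1) r := by
        refine Finset.sum_congr rfl fun c _ => ?_
        simp only [hQ, hb, (hJ c).2]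
      rw [he]
      refine h.trans (mul_le_mul_of_nonneg_left ?_ hμ)
      refine Finset.sum_le_sum fun r _ => ciSup_le fun c => ?_
      rw [hy]
      have hlt := (hcard (t + 1) (J c)).1 (hJ c).1.le
      obtain ⟨d, hd⟩ := Nat.exists_eq_add_of_lt hlt
      have := hwmono (J c).1 (d + 1) (by have := hcardN (t + 1); omega) r
      rw [hd]
      exact this
    exact h1.trans (mul_le_mul_of_nonneg_left (h2.trans h3) hη0)
  have hpos : 0 < 1 - η * μ := by linarith
  intro t
  induction t with
  | zero =>
    intro _
    have h0 : ∀ r, y 0 r = 1 := by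
      intro r
      rw [hytel, Finset.filter_false_of_mem]
      · simp
      · intro j _
        have := (hp j).1
        omega
    simp [h0]
  | succ t ih =>
    intro ht
    have ih' := ih (by omega)
    have hs := hphase1 t ht
    have hexp : 1 / (1 - η * μ) ≤ Real.exp (η * μ / (1 - η * μ)) := by
      have := Real.add_one_le_exp (η * μ / (1 - η * μ))
      have he : 1 / (1 - η * μ) = η * μ / (1 - η * μ) + 1 := by
        field_simp
        ring
      rw [he]; exact this
    have hsplit : Real.exp (((t + 1 : ℕ) : ℝ) * (η * μ) / (1 - η * μ))
        = Real.exp ((t : ℝ) * (η * μ) / (1 - η * μ)) * Real.exp (η * μ / (1 - η * μ)) := by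
      rw [← Real.exp_add]
      congr 1
      push_cast
      ring
    rw [hsplit, ← mul_assoc]
    calc ∑ r ∈ S, y (t + 1) r ≤ (∑ r ∈ S, y t r) * (1 / (1 - η * μ)) := by
          rw [mul_one_div, le_div_iff₀ hpos]
          linarith
      _ ≤ ((S.card : ℝ) * Real.exp ((t : ℝ) * (η * μ) / (1 - η * μ))) * (1 / (1 - η * μ)) :=
          mul_le_mul_of_nonneg_right ih' (one_div_pos.mpr hpos).le
      _ ≤ _ := mul_le_mul_of_nonneg_left hexp (mul_nonneg (Nat.cast_nonneg _) (Real.exp_pos _).le)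
end

section
/- Let an instance of the block-angular min-max resource sharing problem with a σ-approximate block solver be given, let η := e^ε − 1 and assume η σ λ* < 1. Then in any run of the core algorithm with parameters ε > 0 and T phases, for all t = 0, 1, …, T: ‖y^{(t)}‖_1 ≤ m · exp( (η σ / (1 − η σ λ*)) · ∑_{p=1}^{t} Θ_p ), where Θ_p := (∑_{C∈𝒞} inf_{x∈X_C} ⟨y^{(p)}, x⟩) / ‖y^{(p)}‖_1. -/
open scoped BigOperators

lemma aux_card {N : ℕ} (p : Fin N → ℕ) (hpmono : ∀ j k : Fin N, j ≤ k → p j ≤ p k) (t : ℕ)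
    (j : Fin N) : p j ≤ t ↔ j.1 < (Finset.univ.filter (fun j : Fin N => p j ≤ t)).card := by
  constructor
  · intro h
    have h1 : Finset.Iic j ⊆ Finset.univ.filter (fun j : Fin N => p j ≤ t) := by
      intro k hk
      simp only [Finset.mem_Iic] at hk
      simp only [Finset.mem_filter, Finset.mem_univ, true_and]
      exact (hpmono k j hk).trans h
    have h2 := Finset.card_le_card h1
    rw [Fin.card_Iic] at h2
    omega
  · intro h
    by_contra hn
    have h1 : Finset.univ.filter (fun j : Fin N => p j ≤ t) ⊆ Finset.Iio j := by
      intro k hk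
      simp only [Finset.mem_filter, Finset.mem_univ, true_and] at hk
      simp only [Finset.mem_Iio]
      by_contra hkj
      exact hn ((hpmono j k (not_lt.mp hkj)).trans hk)
    have h2 := Finset.card_le_card h1
    rw [Fin.card_Iio] at h2
    omega

lemma aux_exp (ε u : ℝ) (h0 : 0 ≤ u) (h1 : u ≤ 1) :
    Real.exp (ε * u) ≤ 1 + (Real.exp ε - 1) * u := by
  have h := convexOn_exp.2 (Set.mem_univ (0:ℝ)) (Set.mem_univ ε)
    (by linarith : (0:ℝ) ≤ 1 - u) h0 (by ring)
  simp only [smul_eq_mul, mul_zero, zero_add, Real.exp_zero] at h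
  rw [mul_comm ε u]
  linarith

lemma aux_final (A B a l : ℝ) (hA : 0 < A) (ha : 0 ≤ a) (hal : a ≤ l) (hl : l < 1)
    (h : A - B ≤ a * A) : A ≤ B * Real.exp (a / (1 - l)) := by
  have h1 : a / (1 - a) ≤ a / (1 - l) := by
    apply div_le_div_of_nonneg_left ha <;> linarith
  have h2 := Real.add_one_le_exp (a / (1 - l))
  have h3 : (1 - a) * (a / (1 - a) + 1) = 1 := by
    have : (1 - a) ≠ 0 := by linarith
    field_simp
    ring
  have h4 : 1 ≤ (1 - a) * Real.exp (a / (1 - l)) := by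
    refine h3.symm.le.trans ?_
    apply mul_le_mul_of_nonneg_left <;> linarith
  have h5 : A * (1 - a) ≤ B := by linarith
  calc A ≤ A * ((1 - a) * Real.exp (a / (1 - l))) := le_mul_of_one_le_right hA.le h4
    _ = (A * (1 - a)) * Real.exp (a / (1 - l)) := by ring
    _ ≤ _ := mul_le_mul_of_nonneg_right h5 (Real.exp_pos _).le

/-- With `η := e^ε − 1` and `η σ λ* < 1`, in any run of the core
algorithm the end-of-phase prices satisfy
`‖y^{(t)}‖_1 ≤ m · exp((η σ / (1 − η σ λ*)) · ∑_{p=1}^t Θ_p)` for all `t = 0,1,…,T`,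
where `Θ_p` is the dual objective value of the (normalized) price vector `y^{(p)}`. -/
theorem stmt_6 (m : ℕ) (hm : 1 ≤ m)
    (𝒞 : Type) [Fintype 𝒞] [Nonempty 𝒞] [DecidableEq 𝒞]
    (X : 𝒞 → Set (Fin m → ℝ))
    (hXne : ∀ c, (X c).Nonempty) (hXcl : ∀ c, IsClosed (X c))
    (hXcv : ∀ c, Convex ℝ (X c))
    (hXpos : ∀ c, ∀ x ∈ X c, ∀ r, 0 ≤ x r)
    (𝒳 : Set (Fin m → ℝ))
    (h𝒳 : 𝒳 = {x | ∃ g : 𝒞 → Fin m → ℝ, (∀ c, g c ∈ X c) ∧ x = ∑ c, g c})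
    (lam : ℝ) (hlam : lam = ⨅ x : 𝒳, ‖(x : Fin m → ℝ)‖)
    (σ : ℝ) (hσ : 1 ≤ σ)
    (f : 𝒞 → (Fin m → ℝ) → (Fin m → ℝ))
    (hfmem : ∀ c y, (∀ r, 0 ≤ y r) → f c y ∈ X c)
    (hfapx : ∀ c y, (∀ r, 0 ≤ y r) →
      ∑ r, y r * f c y r ≤ σ * ⨅ x : X c, ∑ r, y r * (x : Fin m → ℝ) r)
    (ε : ℝ) (hε : 0 < ε) (η : ℝ) (hη : η = Real.exp ε - 1) (heta_sigma_lam : η * σ * lam < 1)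
    -- a run of the core algorithm with parameters ε and T
    (T : ℕ) (N : ℕ) (p : Fin N → ℕ) (Cu : Fin N → 𝒞) (ξ : Fin N → ℝ)
    (hp : ∀ j, 1 ≤ p j ∧ p j ≤ T)
    (hpmono : ∀ j k : Fin N, j ≤ k → p j ≤ p k)
    (hξ0 : ∀ j, 0 ≤ ξ j)
    (w : ℕ → Fin m → ℝ) (hw0 : w 0 = fun _ => 1)
    (b : Fin N → Fin m → ℝ) (hb : ∀ j, b j = f (Cu j) (w j.1))
    (hwsucc : ∀ j : Fin N, w (j.1 + 1) = fun r => w j.1 r * Real.exp (ε * ξ j * b j r))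
    (hstep : ∀ j, ξ j * ‖b j‖ ≤ 1)
    (hphase : ∀ t, 1 ≤ t → t ≤ T → ∀ c,
      ∑ j ∈ Finset.univ.filter (fun j => p j = t ∧ Cu j = c), ξ j = 1)
    (y : ℕ → Fin m → ℝ)
    (hy : ∀ t, y t = w (Finset.univ.filter (fun j : Fin N => p j ≤ t)).card)
    (Θ : ℕ → ℝ)
    (hΘ : ∀ t, Θ t = (∑ c, ⨅ x : X c, ∑ r, y t r * (x : Fin m → ℝ) r) / ∑ r, |y t r|) :
    ∀ t ≤ T, ∑ r, |y t r| ≤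
      (m : ℝ) * Real.exp (η * σ / (1 - η * σ * lam) * ∑ q ∈ Finset.Icc 1 t, Θ q) := by
  classical
  have hη0 : 0 ≤ η := by
    rw [hη]; linarith [Real.add_one_le_exp ε]
  have hσ0 : 0 ≤ σ := by linarith
  -- the block optimum
  obtain ⟨opt, hopt⟩ : ∃ opt : 𝒞 → (Fin m → ℝ) → ℝ,
      ∀ c v, opt c v = ⨅ x : X c, ∑ r, v r * (x : Fin m → ℝ) r := ⟨_, fun _ _ => rfl⟩
  simp only [← hopt] at hfapx hΘ
  have hne : ∀ c, Nonempty (X c) := fun c => (hXne c).to_subtype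
  have hbdd : ∀ c (v : Fin m → ℝ), (∀ r, 0 ≤ v r) →
      BddBelow (Set.range fun x : X c => ∑ r, v r * (x : Fin m → ℝ) r) := by
    intro c v hv
    refine ⟨0, ?_⟩
    rintro _ ⟨x, rfl⟩
    exact Finset.sum_nonneg fun r _ => mul_nonneg (hv r) (hXpos c x x.2 r)
  have hopt0 : ∀ c (v : Fin m → ℝ), (∀ r, 0 ≤ v r) → 0 ≤ opt c v := by
    intro c v hv
    rw [hopt]
    exact Real.iInf_nonneg fun x =>
      Finset.sum_nonneg fun r _ => mul_nonneg (hv r) (hXpos c x x.2 r)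
  have hoptmono : ∀ c (v v' : Fin m → ℝ), (∀ r, 0 ≤ v r) → (∀ r, v r ≤ v' r) →
      opt c v ≤ opt c v' := by
    intro c v v' hv hvv
    rw [hopt, hopt]
    apply ciInf_mono (hbdd c v hv)
    intro x
    exact Finset.sum_le_sum fun r _ => mul_le_mul_of_nonneg_right (hvv r) (hXpos c x x.2 r)
  have hoptle : ∀ c (v : Fin m → ℝ), (∀ r, 0 ≤ v r) → ∀ x ∈ X c, opt c v ≤ ∑ r, v r * x r := by
    intro c v hv x hx
    rw [hopt]
    exact ciInf_le (hbdd c v hv) ⟨x, hx⟩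
  -- positivity of the prices
  have hwpos : ∀ k, k ≤ N → ∀ r, 0 < w k r := by
    intro k
    induction k with
    | zero => intro _ r; rw [hw0]; norm_num
    | succ k ih =>
      intro hk r
      have h := hwsucc ⟨k, by omega⟩
      simp only at h
      rw [h]
      exact mul_pos (ih (by omega) r) (Real.exp_pos _)
  have hbpos : ∀ j r, 0 ≤ b j r := by
    intro j r
    rw [hb]
    exact hXpos _ _ (hfmem _ _ fun r => (hwpos j.1 j.2.le r).le) r
  have hwmono : ∀ l, l ≤ N → ∀ k, k ≤ l → ∀ r, w k r ≤ w l r := by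
    intro l
    induction l with
    | zero =>
      intro _ k hk r
      have : k = 0 := by omega
      rw [this]
    | succ l ih =>
      intro hl k hk r
      rcases Nat.lt_or_ge l k with h | h
      · have : k = l + 1 := by omega
        rw [this]
      · refine (ih (by omega) k h r).trans ?_
        have h' := hwsucc ⟨l, by omega⟩
        simp only at h'
        rw [h']
        refine le_mul_of_one_le_right (hwpos l (by omega) r).le (Real.one_le_exp ?_)
        exact mul_nonneg (mul_nonneg hε.le (hξ0 _)) (hbpos _ r)
  -- one step
  have hone : ∀ j : Fin N, ∑ r, w (j.1 + 1) r ≤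
      ∑ r, w j.1 r + η * σ * (ξ j * opt (Cu j) (w j.1)) := by
    intro j
    have hw' : ∀ r, 0 ≤ w j.1 r := fun r => (hwpos j.1 j.2.le r).le
    have h1 : ∀ r, w (j.1 + 1) r ≤ w j.1 r + η * ξ j * (w j.1 r * b j r) := by
      intro r
      have hu1 : ξ j * b j r ≤ 1 := by
        refine le_trans (mul_le_mul_of_nonneg_left ?_ (hξ0 j)) (hstep j)
        exact (le_abs_self _).trans (norm_le_pi_norm (b j) r)
      have := aux_exp ε (ξ j * b j r) (mul_nonneg (hξ0 j) (hbpos j r)) hu1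
      rw [← hη, ← mul_assoc] at this
      rw [hwsucc]
      have h2 := mul_le_mul_of_nonneg_left this (hw' r)
      simp only
      refine h2.trans (le_of_eq ?_)
      ring
    have h3 : ∑ r, w (j.1 + 1) r ≤ ∑ r, w j.1 r + η * ξ j * ∑ r, w j.1 r * b j r := by
      rw [Finset.mul_sum, ← Finset.sum_add_distrib]
      exact Finset.sum_le_sum fun r _ => h1 r
    have h4 := hfapx (Cu j) (w j.1) hw'
    rw [← hb j] at h4
    have h5 := mul_le_mul_of_nonneg_left h4 (mul_nonneg hη0 (hξ0 j))
    refine h3.trans ?_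
    have : η * ξ j * (σ * opt (Cu j) (w j.1)) = η * σ * (ξ j * opt (Cu j) (w j.1)) := by ring
    linarith
  obtain ⟨n, hn⟩ : ∃ n : ℕ → ℕ,
      ∀ t, n t = (Finset.univ.filter (fun j : Fin N => p j ≤ t)).card := ⟨_, fun _ => rfl⟩
  have hnN : ∀ t, n t ≤ N := by
    intro t
    rw [hn]
    exact (Finset.card_le_univ _).trans (by simp)
  have hnp : ∀ t (j : Fin N), p j ≤ t ↔ j.1 < n t := by
    intro t j
    rw [hn]
    exact aux_card p hpmono t j
  have hyw : ∀ t, y t = w (n t) := by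
    intro t; rw [hy, hn]
  have hypos : ∀ t r, 0 < y t r := by
    intro t r; rw [hyw]; exact hwpos _ (hnN t) r
  have hn1 : ∀ t, n t ≤ n (t + 1) := by
    intro t
    rw [hn, hn]
    apply Finset.card_le_card
    intro j
    simp only [Finset.mem_filter, Finset.mem_univ, true_and]
    omega
  have hyabs : ∀ t, ∑ r, |y t r| = ∑ r, y t r := fun t =>
    Finset.sum_congr rfl fun r _ => abs_of_pos (hypos t r)
  -- a phase
  have hph : ∀ t, t + 1 ≤ T → ∑ r, y (t + 1) r ≤
      ∑ r, y t r + η * σ * ∑ c, opt c (y (t + 1)) := by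
    intro t ht
    have key : ∀ k, n t ≤ k → k ≤ n (t + 1) → ∑ r, w k r ≤ ∑ r, w (n t) r +
        η * σ * ∑ j ∈ Finset.univ.filter (fun j : Fin N => p j = t + 1 ∧ j.1 < k),
          ξ j * opt (Cu j) (y (t + 1)) := by
      intro k hk
      induction k, hk using Nat.le_induction with
      | base =>
        intro _
        have : 0 ≤ η * σ * ∑ j ∈ Finset.univ.filter (fun j : Fin N => p j = t + 1 ∧ j.1 < n t),
          ξ j * opt (Cu j) (y (t + 1)) :=
          mul_nonneg (mul_nonneg hη0 hσ0) (Finset.sum_nonneg fun j _ =>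
            mul_nonneg (hξ0 j) (hopt0 _ _ fun r => (hypos _ r).le))
        linarith
      | succ k hk ih =>
        intro hk2
        have hkN : k < N := by have := hnN (t + 1); omega
        have ih' := ih (by omega)
        have h1 := hone ⟨k, hkN⟩
        simp only at h1
        have hpk : p ⟨k, hkN⟩ = t + 1 := by
          have a1 := hnp t ⟨k, hkN⟩
          have a2 := hnp (t + 1) ⟨k, hkN⟩
          simp only at a1 a2
          omega
        have hset : Finset.univ.filter (fun j : Fin N => p j = t + 1 ∧ j.1 < k + 1) =
            insert ⟨k, hkN⟩ (Finset.univ.filter (fun j : Fin N => p j = t + 1 ∧ j.1 < k)) := by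
          ext j
          simp only [Finset.mem_filter, Finset.mem_univ, true_and, Finset.mem_insert]
          constructor
          · rintro ⟨h, h'⟩
            rcases Nat.lt_or_ge j.1 k with h2 | h2
            · exact Or.inr ⟨h, h2⟩
            · left; apply Fin.ext; simp only; omega
          · rintro (h | ⟨h, h'⟩)
            · subst h; exact ⟨hpk, by simp⟩
            · exact ⟨h, by omega⟩
        rw [hset, Finset.sum_insert (by simp), mul_add]
        have h2 : opt (Cu ⟨k, hkN⟩) (w k) ≤ opt (Cu ⟨k, hkN⟩) (y (t + 1)) := by
          apply hoptmono _ _ _ (fun r => (hwpos k hkN.le r).le)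
          intro r
          rw [hyw]
          exact hwmono _ (hnN _) _ (by omega) r
        have h3 := mul_le_mul_of_nonneg_left (mul_le_mul_of_nonneg_left h2 (hξ0 ⟨k, hkN⟩))
          (mul_nonneg hη0 hσ0)
        linarith
    have h1 := key (n (t + 1)) (hn1 t) le_rfl
    rw [← hyw, ← hyw] at h1
    have h2 : Finset.univ.filter (fun j : Fin N => p j = t + 1 ∧ j.1 < n (t + 1)) =
        Finset.univ.filter (fun j : Fin N => p j = t + 1) := by
      apply Finset.filter_congr
      intro j _
      have := hnp (t + 1) j
      constructor
      · exact fun h => h.1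
      · exact fun h => ⟨h, this.1 h.le⟩
    have h3 : ∑ j ∈ Finset.univ.filter (fun j : Fin N => p j = t + 1),
        ξ j * opt (Cu j) (y (t + 1)) = ∑ c, opt c (y (t + 1)) := by
      rw [← Finset.sum_fiberwise (Finset.univ.filter (fun j : Fin N => p j = t + 1)) Cu]
      apply Finset.sum_congr rfl
      intro c _
      rw [Finset.filter_filter]
      rw [← one_mul (opt c (y (t + 1))), ← hphase (t + 1) (by omega) ht c, Finset.sum_mul]
      apply Finset.sum_congr rfl
      intro j hj
      simp only [Finset.mem_filter, Finset.mem_univ, true_and] at hj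
      rw [hj.2]
    rw [h2, h3] at h1
    exact h1
  have hm' : (Finset.univ : Finset (Fin m)).Nonempty := ⟨⟨0, hm⟩, Finset.mem_univ _⟩
  have hYpos : ∀ t, 0 < ∑ r, y t r := fun t => Finset.sum_pos (fun r _ => hypos t r) hm'
  have hΘ0 : ∀ t, 0 ≤ Θ t := by
    intro t
    rw [hΘ, hyabs]
    exact div_nonneg (Finset.sum_nonneg fun c _ => hopt0 c _ fun r => (hypos t r).le) (hYpos t).le
  have hΘl : ∀ t, Θ t ≤ lam := by
    intro t
    have hne𝒳 : Nonempty 𝒳 := by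
      choose g hg using hXne
      exact ⟨⟨∑ c, g c, by rw [h𝒳]; exact ⟨g, hg, rfl⟩⟩⟩
    rw [hlam]
    apply le_ciInf
    rintro ⟨x, hx⟩
    rw [h𝒳] at hx
    obtain ⟨g, hg, rfl⟩ := hx
    rw [hΘ, hyabs, div_le_iff₀ (hYpos t)]
    calc ∑ c, opt c (y t) ≤ ∑ c, ∑ r, y t r * g c r :=
          Finset.sum_le_sum fun c _ => hoptle c _ (fun r => (hypos t r).le) _ (hg c)
      _ = ∑ r, y t r * (∑ c, g c) r := by
          rw [Finset.sum_comm]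
          apply Finset.sum_congr rfl
          intro r _
          rw [Finset.sum_apply, Finset.mul_sum]
      _ ≤ ∑ r, y t r * ‖∑ c, g c‖ := by
          apply Finset.sum_le_sum
          intro r _
          apply mul_le_mul_of_nonneg_left _ (hypos t r).le
          exact (le_abs_self _).trans (norm_le_pi_norm (∑ c, g c) r)
      _ = ‖∑ c, g c‖ * ∑ r, y t r := by rw [← Finset.sum_mul, mul_comm]
  intro t
  induction t with
  | zero =>
    intro _
    have h0 : n 0 = 0 := by
      rw [hn, Finset.card_eq_zero, Finset.filter_eq_empty_iff]
      intro j _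
      have := (hp j).1
      omega
    rw [hyw, h0, hw0]
    simp
  | succ t ih =>
    intro ht
    have ih' := ih (by omega)
    rw [hyabs] at ih' ⊢
    rw [Finset.sum_Icc_succ_top (by omega), mul_add, Real.exp_add, ← mul_assoc]
    have hησ : 0 ≤ η * σ := mul_nonneg hη0 hσ0
    have h1 : ∑ c, opt c (y (t + 1)) = Θ (t + 1) * ∑ r, y (t + 1) r := by
      rw [hΘ, hyabs, div_mul_cancel₀ _ (hYpos _).ne']
    have h2 := hph t ht
    rw [h1] at h2
    have h3 := aux_final (∑ r, y (t + 1) r) (∑ r, y t r) (η * σ * Θ (t + 1)) (η * σ * lam)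
      (hYpos _) (mul_nonneg hησ (hΘ0 _)) (mul_le_mul_of_nonneg_left (hΘl _) hησ)
      heta_sigma_lam (by linarith)
    rw [mul_div_right_comm] at h3
    exact h3.trans (mul_le_mul_of_nonneg_right ih' (Real.exp_pos _).le)
end

section
/- Let an instance of the block-angular min-max resource sharing problem with a σ-approximate block solver be given with m ≥ 2 and λ* > 0, and let δ ∈ (0,1]. Then there exist a primal solution x ∈ 𝒳 and a dual solution z ∈ Δ_m such that: ‖x‖_∞ ≤ (1+δ) σ λ*; inf_{x'∈𝒳} ⟨z, x'⟩ ≥ (1−δ) λ*/σ; and for every nonempty S ⊆ ℛ and every μ > 0 such that the instance satisfies local weak duality with respect to S and μ, max_{r∈S} x_r ≤ μ + δ · max{λ*, μ}. -/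
open scoped BigOperators


/-- Potential estimate for multiplicative price updates. -/
lemma potential_bound {m : ℕ} (P g : ℕ → Fin m → ℝ) (h η κ μ : ℝ) (hh : 0 < h) (hη : 0 < η)
    (hκ1 : κ ≤ 1) (hμ : 0 ≤ μ) (hκ0 : 0 ≤ κ)
    (hP0 : ∀ r, P 0 r = 0) (hPs : ∀ t r, P (t + 1) r = P t r + h * g t r)
    (hg0 : ∀ t r, 0 ≤ g t r) (S : Finset (Fin m)) (n : ℕ)
    (hsmall : ∀ t < n, ∀ r, η * (h * g t r) ≤ κ)
    (hS : ∀ t < n, ∑ r ∈ S, Real.exp (η * P t r) * g t r ≤ μ * ∑ r ∈ S, Real.exp (η * P t r)) :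
    ∑ r ∈ S, Real.exp (η * P n r) ≤ m * Real.exp (η * (1 + κ) * μ * (h * n)) := by
  induction n with
  | zero =>
    simp only [hP0]
    simp
    exact_mod_cast (Finset.card_le_univ S).trans (by simp)
  | succ n ih =>
    have ih' := ih (fun t ht => hsmall t (by omega)) (fun t ht => hS t (by omega))
    have h1 : ∀ r, Real.exp (η * P (n+1) r) ≤
        Real.exp (η * P n r) + η * h * (1 + κ) * (Real.exp (η * P n r) * g n r) := by
      intro r
      rw [hPs, mul_add, Real.exp_add]
      set u := η * (h * g n r) with hu
      have hu0 : 0 ≤ u := by have := hg0 n r; positivity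
      have huk : u ≤ κ := hsmall n (by omega) r
      have h2 := Real.abs_exp_sub_one_sub_id_le (x := u) (by rw [abs_of_nonneg hu0]; linarith)
      have h3 := (abs_le.1 h2).2
      have h4 : Real.exp u ≤ 1 + (1 + κ) * u := by nlinarith
      calc _ ≤ Real.exp (η * P n r) * (1 + (1 + κ) * u) := by gcongr
        _ = _ := by rw [hu]; ring
    have h5 : ∑ r ∈ S, Real.exp (η * P (n+1) r) ≤
        (∑ r ∈ S, Real.exp (η * P n r)) * (1 + η * (1 + κ) * μ * h) := by
      calc _ ≤ ∑ r ∈ S, (Real.exp (η * P n r) + η * h * (1 + κ) * (Real.exp (η * P n r) * g n r)) :=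
            Finset.sum_le_sum (fun r _ => h1 r)
        _ = ∑ r ∈ S, Real.exp (η * P n r) +
              η * h * (1 + κ) * ∑ r ∈ S, Real.exp (η * P n r) * g n r := by
            rw [Finset.sum_add_distrib, Finset.mul_sum]
        _ ≤ ∑ r ∈ S, Real.exp (η * P n r) +
              η * h * (1 + κ) * (μ * ∑ r ∈ S, Real.exp (η * P n r)) := by
            gcongr
            exact hS n (by omega)
        _ = _ := by ring
    have h6 : 1 + η * (1 + κ) * μ * h ≤ Real.exp (η * (1 + κ) * μ * h) := by
      linarith [Real.add_one_le_exp (η * (1 + κ) * μ * h)]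
    calc _ ≤ _ := h5
      _ ≤ (m * Real.exp (η * (1 + κ) * μ * (h * n))) * Real.exp (η * (1 + κ) * μ * h) := by
          gcongr
      _ = _ := by
          rw [mul_assoc, ← Real.exp_add]
          congr 2
          push_cast
          ring

/-- (Main theorem, existence form.)  For every instance of the
block-angular min-max resource sharing problem with a `σ`-approximate block solver,
`m ≥ 2`, `λ* > 0` and `δ ∈ (0,1]`, there exist a primal solution `x ∈ 𝒳` and a dual
solution `z ∈ Δ_m` with `‖x‖_∞ ≤ (1+δ)σλ*`, `inf_{x'∈𝒳}⟨z,x'⟩ ≥ (1−δ)λ*/σ`, and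
`max_{r∈S} x_r ≤ μ + δ·max{λ*,μ}` whenever local weak duality holds w.r.t. `S, μ`. -/
theorem stmt_10 (m : ℕ) (hm : 2 ≤ m)
    (𝒞 : Type) [Fintype 𝒞] [Nonempty 𝒞]
    (X : 𝒞 → Set (Fin m → ℝ))
    (hXne : ∀ c, (X c).Nonempty) (hXcl : ∀ c, IsClosed (X c))
    (hXcv : ∀ c, Convex ℝ (X c))
    (hXpos : ∀ c, ∀ x ∈ X c, ∀ r, 0 ≤ x r)
    (𝒳 : Set (Fin m → ℝ))
    (h𝒳 : 𝒳 = {x | ∃ g : 𝒞 → Fin m → ℝ, (∀ c, g c ∈ X c) ∧ x = ∑ c, g c})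
    (lam : ℝ) (hlam : lam = ⨅ x : 𝒳, ‖(x : Fin m → ℝ)‖) (hlam_pos : 0 < lam)
    (σ : ℝ) (hσ : 1 ≤ σ)
    (f : 𝒞 → (Fin m → ℝ) → (Fin m → ℝ))
    (hfmem : ∀ c y, (∀ r, 0 ≤ y r) → f c y ∈ X c)
    (hfapx : ∀ c y, (∀ r, 0 ≤ y r) →
      ∑ r, y r * f c y r ≤ σ * ⨅ x : X c, ∑ r, y r * (x : Fin m → ℝ) r)
    (δ : ℝ) (hδ0 : 0 < δ) (hδ1 : δ ≤ 1) :
    ∃ x ∈ 𝒳, ∃ z : Fin m → ℝ,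
      (∀ r, 0 ≤ z r ∧ z r ≤ 1) ∧ (∑ r, z r = 1) ∧
      ‖x‖ ≤ (1 + δ) * σ * lam ∧
      (1 - δ) * lam / σ ≤ (⨅ x' : 𝒳, ∑ r, z r * (x' : Fin m → ℝ) r) ∧
      (∀ (S : Finset (Fin m)), S.Nonempty → ∀ μ : ℝ, 0 < μ →
        (∀ y : 𝒞 → Fin m → ℝ, (∀ c r, 0 ≤ y c r) →
          ∑ c, ∑ r ∈ S, y c r * f c (y c) r ≤ μ * ∑ r ∈ S, ⨆ c, y c r) →
        ∀ r ∈ S, x r ≤ μ + δ * max lam μ) := by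
  classical
  -- weak duality for the block solver
  have hsum : ∀ y : Fin m → ℝ, (∀ r, 0 ≤ y r) → ∀ x' ∈ 𝒳,
      ∑ r, y r * (∑ c, f c y r) ≤ σ * ∑ r, y r * x' r := by
    intro y hy x' hx'
    rw [h𝒳] at hx'
    obtain ⟨g, hg, rfl⟩ := hx'
    calc ∑ r, y r * (∑ c, f c y r) = ∑ c, ∑ r, y r * f c y r := by
          simp_rw [Finset.mul_sum]; exact Finset.sum_comm
      _ ≤ ∑ c, σ * ∑ r, y r * g c r := by
          refine Finset.sum_le_sum fun c _ => (hfapx c y hy).trans ?_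
          refine mul_le_mul_of_nonneg_left ?_ (by linarith)
          refine ciInf_le (f := fun x : X c => ∑ r, y r * (x : Fin m → ℝ) r) ?_ ⟨g c, hg c⟩
          refine ⟨0, ?_⟩
          rintro _ ⟨x, rfl⟩
          exact Finset.sum_nonneg fun r _ => mul_nonneg (hy r) (hXpos c x x.2 r)
      _ = _ := by
          rw [← Finset.mul_sum, Finset.sum_comm]
          simp_rw [Finset.sum_apply, Finset.mul_sum]
  have hne : Nonempty 𝒳 := by
    choose g hg using hXne
    exact ⟨⟨∑ c, g c, by rw [h𝒳]; exact ⟨g, hg, rfl⟩⟩⟩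
  have hσ0 : 0 < σ := by linarith
  have hlam_le : ∀ x ∈ 𝒳, lam ≤ ‖x‖ := by
    intro x hx
    rw [hlam]
    exact ciInf_le (f := fun x : 𝒳 => ‖(x : Fin m → ℝ)‖)
      ⟨0, by rintro _ ⟨x, rfl⟩; exact norm_nonneg _⟩ ⟨x, hx⟩
  have hglob : ∀ y : Fin m → ℝ, (∀ r, 0 < y r) →
      ∑ r, y r * (∑ c, f c y r) ≤ (σ * lam) * ∑ r, y r := by
    intro y hy
    have hY : 0 < ∑ r, y r :=
      Finset.sum_pos (fun r _ => hy r) ⟨⟨0, by omega⟩, Finset.mem_univ _⟩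
    have : (∑ r, y r * (∑ c, f c y r)) / (σ * ∑ r, y r) ≤ lam := by
      rw [hlam]
      refine le_ciInf fun x' => ?_
      rw [div_le_iff₀ (by positivity)]
      refine (hsum y (fun r => (hy r).le) x' x'.2).trans ?_
      have : ∑ r, y r * (x' : Fin m → ℝ) r ≤ ∑ r, y r * ‖(x' : Fin m → ℝ)‖ := by
        refine Finset.sum_le_sum fun r _ => mul_le_mul_of_nonneg_left ?_ (hy r).le
        exact (le_abs_self _).trans (norm_le_pi_norm (x' : Fin m → ℝ) r)
      rw [← Finset.sum_mul] at this
      calc _ ≤ _ := mul_le_mul_of_nonneg_left this hσ0.le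
        _ = _ := by ring
    rw [div_le_iff₀ (by positivity)] at this
    linarith
  have hm1 : (1:ℝ) < m := by exact_mod_cast (by omega : 1 < m)
  have hlog : 0 < Real.log m := Real.log_pos hm1
  obtain ⟨η, hηdef⟩ : ∃ η : ℝ, η = 2 * Real.log m / (δ * lam) := ⟨_, rfl⟩
  have hη : 0 < η := by rw [hηdef]; positivity
  have hηlog : Real.log m = η * (δ * lam / 2) := by rw [hηdef]; field_simp
  obtain ⟨κ, hκ⟩ : ∃ κ : ℝ, κ = δ / 2 := ⟨_, rfl⟩
  have hκ0 : 0 < κ := by rw [hκ]; positivity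
  have hκ1 : κ ≤ 1 := by linarith
  obtain ⟨B, hB⟩ : ∃ B : ℝ, B = σ * lam * (m * Real.exp (η * (1 + κ) * (σ * lam))) := ⟨_, rfl⟩
  obtain ⟨N, hN⟩ := exists_nat_gt (max 1 (η * B / κ))
  have hN1 : (1:ℝ) < N := (le_max_left _ _).trans_lt hN
  have hN0 : (0:ℝ) < N := by linarith
  have hN2 : η * B / κ < N := (le_max_right _ _).trans_lt hN
  obtain ⟨h, hh⟩ : ∃ h : ℝ, h = 1 / (N:ℝ) := ⟨_, rfl⟩
  have hh0 : 0 < h := by rw [hh]; positivity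
  have hhN : h * N = 1 := by rw [hh]; field_simp
  -- the dynamics
  let E : (Fin m → ℝ) → Fin m → ℝ := fun p r => Real.exp (η * p r)
  let G : (Fin m → ℝ) → Fin m → ℝ := fun p r => ∑ c, f c (E p) r
  let P : ℕ → Fin m → ℝ := fun n => Nat.rec 0 (fun _ p r => p r + h * G p r) n
  have hE : ∀ p r, 0 < E p r := fun p r => Real.exp_pos _
  have hP0 : ∀ r, P 0 r = 0 := fun r => rfl
  have hPs : ∀ t r, P (t + 1) r = P t r + h * G (P t) r := fun t r => rfl
  have hfm : ∀ c p, f c (E p) ∈ X c := fun c p => hfmem c _ (fun r => (hE p r).le)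
  have hG0 : ∀ p r, 0 ≤ G p r := fun p r =>
    Finset.sum_nonneg fun c _ => hXpos c _ (hfm c p) r
  have hPnn : ∀ t r, 0 ≤ P t r := by
    intro t r
    induction t with
    | zero => simp [hP0]
    | succ t ih => rw [hPs]; have := hG0 (P t) r; positivity
  have hpot := fun μ (hμ : 0 ≤ μ) => potential_bound P (fun t => G (P t)) h η κ μ hh0 hη hκ1 hμ
    hκ0.le hP0 hPs (fun t r => hG0 (P t) r)
  have hsmall : ∀ n ≤ N, ∀ t < n, ∀ r, η * (h * G (P t) r) ≤ κ := by
    intro n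
    induction n with
    | zero => intro _ t ht; omega
    | succ n ih =>
      intro hn t ht r
      have ih' := ih (by omega)
      rcases Nat.lt_succ_iff_lt_or_eq.1 ht with h1 | rfl
      · exact ih' t h1 r
      have h2 := hpot (σ * lam) (by positivity) Finset.univ t ih'
        (fun s _ => hglob (E (P s)) (hE _))
      have h3 : h * t ≤ 1 := by
        rw [← hhN]
        have : (t:ℝ) ≤ N := by exact_mod_cast (by omega : t ≤ N)
        gcongr
      have h4 : Real.exp (η * (1 + κ) * (σ * lam) * (h * t)) ≤
          Real.exp (η * (1 + κ) * (σ * lam)) := by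
        apply Real.exp_le_exp.2
        exact mul_le_of_le_one_right (by positivity) h3
      have h5 : G (P t) r ≤ B := by
        calc G (P t) r ≤ E (P t) r * G (P t) r := by
              apply le_mul_of_one_le_left (hG0 _ _)
              exact Real.one_le_exp (mul_nonneg hη.le (hPnn t r))
          _ ≤ ∑ r, E (P t) r * G (P t) r :=
              Finset.single_le_sum (f := fun r => E (P t) r * G (P t) r)
                (fun r _ => mul_nonneg (hE _ _).le (hG0 _ _)) (Finset.mem_univ r)
          _ ≤ (σ * lam) * ∑ r, E (P t) r := hglob (E (P t)) (hE _)
          _ ≤ B := by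
              rw [hB]
              refine mul_le_mul_of_nonneg_left (h2.trans ?_) (by positivity)
              gcongr
      rw [div_lt_iff₀ hκ0] at hN2
      calc η * (h * G (P t) r) ≤ η * (h * B) := by gcongr
        _ = h * (η * B) := by ring
        _ ≤ h * (N * κ) := by gcongr
        _ = κ := by rw [← mul_assoc, hhN, one_mul]
  -- final bound
  have hfin : ∀ (S : Finset (Fin m)) (μ : ℝ), 0 ≤ μ →
      (∀ t < N, ∑ r ∈ S, E (P t) r * G (P t) r ≤ μ * ∑ r ∈ S, E (P t) r) →
      ∀ r ∈ S, P N r ≤ (1 + κ) * μ + δ * lam / 2 := by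
    intro S μ hμ hS r hr
    have h1 := hpot μ hμ S N (hsmall N le_rfl) hS
    rw [hhN, mul_one] at h1
    have h2 : Real.exp (η * P N r) ≤ m * Real.exp (η * (1 + κ) * μ) :=
      (Finset.single_le_sum (f := fun r => Real.exp (η * P N r))
        (fun r _ => (Real.exp_pos _).le) hr).trans h1
    rw [← Real.exp_log (by linarith : (0:ℝ) < m), ← Real.exp_add, Real.exp_le_exp, hηlog] at h2
    refine le_of_mul_le_mul_left (h2.trans (le_of_eq ?_)) hη
    ring
  have hPmem : P N ∈ 𝒳 := by
    rw [h𝒳]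
    refine ⟨fun c => ∑ t ∈ Finset.range N, h • f c (E (P t)), fun c => ?_, ?_⟩
    · refine (hXcv c).sum_mem (fun _ _ => hh0.le) ?_ (fun t _ => hfm c _)
      simp [mul_comm, hhN]
    · have : ∀ n r, P n r = ∑ t ∈ Finset.range n, h * G (P t) r := by
        intro n r
        induction n with
        | zero => simp [hP0]
        | succ n ih => rw [hPs, ih, Finset.sum_range_succ]
      ext r
      rw [this, Finset.sum_comm]
      simp [G, Finset.sum_apply, Finset.mul_sum]
  have hnorm : ∀ b : ℝ, 0 ≤ b → (∀ r, P N r ≤ b) → ‖P N‖ ≤ b := by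
    intro b hb hr
    rw [pi_norm_le_iff_of_nonneg hb]
    intro r
    rw [Real.norm_of_nonneg (hPnn N r)]
    exact hr r
  -- dual solution
  have hdual : ∃ t, ∀ x' ∈ 𝒳, (1 - δ) * lam / σ ≤
      ∑ r, (E (P t) r / ∑ s, E (P t) s) * x' r := by
    by_contra hcon
    push Not at hcon
    have h1 := hfin Finset.univ ((1 - δ) * lam) (mul_nonneg (by linarith) hlam_pos.le) (by
      intro t _
      obtain ⟨x', hx', hlt⟩ := hcon t
      have hY : 0 < ∑ r, E (P t) r :=
        Finset.sum_pos (fun r _ => hE _ r) ⟨⟨0, by omega⟩, Finset.mem_univ _⟩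
      have h2 := hsum (E (P t)) (fun r => (hE _ r).le) x' hx'
      have h3 : ∑ r, (E (P t) r / ∑ s, E (P t) s) * x' r =
          (∑ r, E (P t) r * x' r) / ∑ s, E (P t) s := by
        rw [Finset.sum_div]
        exact Finset.sum_congr rfl fun r _ => by ring
      rw [h3, div_lt_div_iff₀ hY hσ0] at hlt
      refine h2.trans ?_
      linarith)
    have h4 := hlam_le _ hPmem
    have h5 := hnorm ((1 + κ) * ((1 - δ) * lam) + δ * lam / 2)
      (by have : 0 ≤ 1 - δ := by linarith
          positivity) (fun r => h1 r (Finset.mem_univ r))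
    rw [hκ] at h5
    have : 0 < δ ^ 2 * lam := by positivity
    nlinarith
  obtain ⟨t, ht⟩ := hdual
  have hY : 0 < ∑ r, E (P t) r :=
    Finset.sum_pos (fun r _ => hE _ r) ⟨⟨0, by omega⟩, Finset.mem_univ _⟩
  refine ⟨P N, hPmem, fun r => E (P t) r / ∑ s, E (P t) s, ?_, ?_, ?_, ?_, ?_⟩
  · intro r
    refine ⟨div_nonneg (hE _ r).le hY.le, ?_⟩
    rw [div_le_one hY]
    exact Finset.single_le_sum (f := fun r => E (P t) r) (fun r _ => (hE _ r).le)
      (Finset.mem_univ r)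
  · rw [← Finset.sum_div, div_self hY.ne']
  · refine hnorm _ (by positivity) fun r => ?_
    have h1 := hfin Finset.univ (σ * lam) (by positivity)
      (fun t _ => hglob (E (P t)) (hE _)) r (Finset.mem_univ r)
    rw [hκ] at h1
    have : lam ≤ σ * lam := le_mul_of_one_le_left hlam_pos.le hσ
    nlinarith
  · exact le_ciInf fun x' => ht x' x'.2
  · intro S _ μ hμ hloc r hr
    have h1 := hfin S μ hμ.le (by
      intro t _
      have h2 := hloc (fun _ => E (P t)) (fun _ r => (hE _ r).le)
      simp only [ciSup_const] at h2
      refine le_trans (le_of_eq ?_) h2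
      rw [Finset.sum_comm]
      exact Finset.sum_congr rfl fun r _ => by simp only [G, Finset.mul_sum]) r hr
    rw [hκ] at h1
    have h3 : δ * lam ≤ δ * max lam μ := by gcongr; exact le_max_left _ _
    have h4 : δ * μ ≤ δ * max lam μ := by gcongr; exact le_max_right _ _
    linarith
end

section
/- Let X ⊆ ℝ^m_{≥0} be a nonempty closed convex set, let λ ∈ X be decreasingly minimal in X, and let I := {i ∈ {1,…,m} : λ_i = ‖λ‖_∞} be the set of coordinates where λ is maximal. Then for every x ∈ X, either x_i = λ_i for all i ∈ I, or there exists j ∈ I with x_j > λ_j. -/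
open scoped BigOperators

/-- The vector `x` with its entries sorted in decreasing order. -/
noncomputable def sortDesc {m : ℕ} (x : Fin m → ℝ) : Fin m → ℝ :=
  fun i => -(((fun j => -x j) ∘ (Tuple.sort fun j => -x j)) i)

/-- The decreasing preorder: `x ≤_dec y`. -/
def decLE {m : ℕ} (x y : Fin m → ℝ) : Prop :=
  sortDesc x = sortDesc y ∨
    ∃ k : Fin m, sortDesc x k < sortDesc y k ∧
      ∀ j : Fin m, j < k → sortDesc x j = sortDesc y j

lemma sortDesc_apply' {m : ℕ} (x : Fin m → ℝ) (j : Fin m) :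
    sortDesc x j = x (Tuple.sort (fun j => -x j) j) := by
  simp [sortDesc]

lemma sortDesc_antitone {m : ℕ} (x : Fin m → ℝ) : Antitone (sortDesc x) := by
  intro i j hij
  have := Tuple.monotone_sort (fun j => -x j) hij
  unfold sortDesc
  linarith

lemma card_sortDesc {m : ℕ} (x : Fin m → ℝ) (c : ℝ) :
    (Finset.univ.filter (fun j => sortDesc x j = c)).card
      = (Finset.univ.filter (fun j => x j = c)).card := by
  apply Finset.card_equiv (Tuple.sort (fun j => -x j))
  intro i
  simp [sortDesc_apply']

/-- Let `X ⊆ ℝ^m_{≥0}` be nonempty closed convex, `λ ∈ X` decreasingly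
minimal and `I` the set of coordinates where `λ` attains its maximum.  Then every `x ∈ X`
either agrees with `λ` on all of `I`, or exceeds `λ` in some coordinate of `I`. -/
theorem stmt_11 (m : ℕ) (hm : 1 ≤ m)
    (X : Set (Fin m → ℝ)) (hne : X.Nonempty) (hcl : IsClosed X) (hcv : Convex ℝ X)
    (hpos : ∀ x ∈ X, ∀ i, 0 ≤ x i)
    (lam : Fin m → ℝ) (hlamX : lam ∈ X) (hdm : ∀ y ∈ X, decLE lam y)
    (I : Finset (Fin m)) (hI : I = Finset.univ.filter (fun i => lam i = ‖lam‖)) :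
    ∀ x ∈ X, (∀ i ∈ I, x i = lam i) ∨ ∃ j ∈ I, lam j < x j := by
  intro x hx
  by_contra hcon
  push Not at hcon
  obtain ⟨⟨i0, hi0, hne0⟩, hle⟩ := hcon
  have hlt0 : x i0 < lam i0 := lt_of_le_of_ne (hle i0 hi0) hne0
  have hM : ∀ i, lam i ≤ ‖lam‖ := fun i => (le_abs_self _).trans (norm_le_pi_norm lam i)
  have hmem : ∀ i, i ∈ I ↔ lam i = ‖lam‖ := by intro i; simp [hI]
  generalize ‖lam‖ = M at hM hmem hI
  have hev : ∀ i, ∀ᶠ t : ℝ in nhdsWithin 0 (Set.Ioi 0), i ∉ I → (1 - t) * lam i + t * x i < M := by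
    intro i
    by_cases hi : i ∈ I
    · simp [hi]
    · have h1 : lam i < M := lt_of_le_of_ne (hM i) (fun h => hi ((hmem i).2 h))
      have hc : Continuous (fun t : ℝ => (1 - t) * lam i + t * x i) := by fun_prop
      have := (hc.tendsto 0).eventually_lt_const (u := M) (by simpa using h1)
      filter_upwards [this.filter_mono nhdsWithin_le_nhds] with t ht _ using ht
  have hev2 : ∀ᶠ t : ℝ in nhdsWithin 0 (Set.Ioi 0), t < 1 ∧ 0 < t := by
    filter_upwards [Ioo_mem_nhdsGT (zero_lt_one (α := ℝ))] with t ht using ⟨ht.2, ht.1⟩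
  obtain ⟨t, hty, ht1, ht0⟩ := ((Filter.eventually_all.2 hev).and hev2).exists
  set y : Fin m → ℝ := (1 - t) • lam + t • x with hy
  have hyi : ∀ i, y i = (1 - t) * lam i + t * x i := by intro i; simp [hy]
  have hyX : y ∈ X := hcv hlamX hx (by linarith) ht0.le (by ring)
  have hyM : ∀ i, y i ≤ M := by
    intro i
    by_cases hi : i ∈ I
    · rw [hyi]; have := hle i hi; have := (hmem i).1 hi; nlinarith
    · rw [hyi]; exact (hty i hi).le
  have hss : Finset.univ.filter (fun i => y i = M) ⊂ I := by
    rw [Finset.ssubset_iff_of_subset]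
    · refine ⟨i0, hi0, ?_⟩
      have := (hmem i0).1 hi0
      simp only [Finset.mem_filter, Finset.mem_univ, true_and, hyi]
      nlinarith
    · intro i hi
      by_contra hiI
      have := hty i hiI
      simp only [Finset.mem_filter, Finset.mem_univ, true_and, hyi] at hi
      linarith
  have hsub : Finset.univ.filter (fun j => sortDesc lam j = M)
      ⊆ Finset.univ.filter (fun j => sortDesc y j = M) := by
    intro j hj
    simp only [Finset.mem_filter, Finset.mem_univ, true_and] at hj ⊢
    rcases hdm y hyX with h | ⟨k, hk, hjk⟩
    · rw [← h, hj]
    · rw [← hjk j ?_, hj]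
      by_contra hnot
      have h1 := sortDesc_antitone lam (not_lt.1 hnot)
      have h2 : sortDesc y k ≤ M := by rw [sortDesc_apply']; exact hyM _
      linarith
  have h1 := Finset.card_le_card hsub
  rw [card_sortDesc, card_sortDesc, ← hI] at h1
  exact absurd (Finset.card_lt_card hss) (not_lt.2 h1)
end

section
/- Let X ⊆ ℝ^m_{≥0} be a nonempty compact convex set and fix a coordinate r* ∈ {1,…,m}. Define φ(y) := min_{x∈X} ⟨y, x⟩ − y_{r*} · min_{x∈X} x_{r*} for y ∈ ℝ^m_{≥0}. Then φ is monotone: for all y, y' ∈ ℝ^m_{≥0} with y ≤ y' coordinatewise, φ(y) ≤ φ(y'). -/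
open scoped BigOperators

/-- For a nonempty compact convex `X ⊆ ℝ^m_{≥0}` and a coordinate `r*`,
the function `φ(y) := min_{x∈X} ⟨y,x⟩ − y_{r*} · min_{x∈X} x_{r*}` is monotone on
nonnegative price vectors. -/
theorem stmt_12 (m : ℕ)
    (X : Set (Fin m → ℝ)) (hne : X.Nonempty) (hcp : IsCompact X) (hcv : Convex ℝ X)
    (hpos : ∀ x ∈ X, ∀ r, 0 ≤ x r)
    (rs : Fin m)
    (φ : (Fin m → ℝ) → ℝ)
    (hφ : ∀ y, φ y = (⨅ x : X, ∑ r, y r * (x : Fin m → ℝ) r)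
        - y rs * ⨅ x : X, (x : Fin m → ℝ) rs) :
    ∀ y y' : Fin m → ℝ, (∀ r, 0 ≤ y r) → (∀ r, 0 ≤ y' r) →
      (∀ r, y r ≤ y' r) → φ y ≤ φ y' := by
  intro y y' hy hy' hle
  haveI : Nonempty X := hne.to_subtype
  rw [hφ, hφ]
  have key : (⨅ x : X, ∑ r, y r * (x : Fin m → ℝ) r)
      + (y' rs - y rs) * (⨅ x : X, (x : Fin m → ℝ) rs)
      ≤ ⨅ x : X, ∑ r, y' r * (x : Fin m → ℝ) r := by
    apply le_ciInf
    intro x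
    have h1 : (⨅ x : X, ∑ r, y r * (x : Fin m → ℝ) r) ≤ ∑ r, y r * (x : Fin m → ℝ) r := by
      refine ciInf_le ⟨0, ?_⟩ x
      rintro _ ⟨z, rfl⟩
      exact Finset.sum_nonneg fun r _ => mul_nonneg (hy r) (hpos z z.2 r)
    have h2 : (⨅ x : X, (x : Fin m → ℝ) rs) ≤ (x : Fin m → ℝ) rs := by
      refine ciInf_le (f := fun x : X => (x : Fin m → ℝ) rs) ⟨0, ?_⟩ x
      rintro _ ⟨z, rfl⟩
      exact hpos z z.2 rs
    have h3 := mul_le_mul_of_nonneg_left h2 (sub_nonneg.2 (hle rs))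
    have h4 : (y' rs - y rs) * (x : Fin m → ℝ) rs
        ≤ ∑ r, (y' r - y r) * (x : Fin m → ℝ) r :=
      Finset.single_le_sum (f := fun r => (y' r - y r) * (x : Fin m → ℝ) r)
        (fun r _ => mul_nonneg (sub_nonneg.2 (hle r)) (hpos x x.2 r)) (Finset.mem_univ rs)
    simp only [sub_mul, Finset.sum_sub_distrib] at h3 h4 ⊢
    linarith
  linarith
end

section
/- Let an instance of the block-angular min-max resource sharing problem with an exact block solver (σ = 1) be given, and suppose it has product structure: ℛ = R_1 ⊔ … ⊔ R_k is a partition and each X_C decomposes as a product X_C = X_1^{(C)} × … × X_k^{(C)} with X_i^{(C)} ⊆ ℝ^{R_i}_{≥0}, identifying ℝ^ℛ with ∏_{i=1}^k ℝ^{R_i}. Set 𝒳_i := ∑_{C∈𝒞} X_i^{(C)}. Then for every j ∈ {1,…,k} the instance satisfies local weak duality with respect to R_j and μ_j := inf_{x_j ∈ 𝒳_j} ‖x_j‖_∞; that is, for every family (y^{(C)})_{C∈𝒞} of vectors in ℝ^ℛ_{≥0}, ∑_{C∈𝒞} ∑_{r∈R_j} y^{(C)}_r · f_C(y^{(C)})_r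 ≤ μ_j · ∑_{r∈R_j} max_{C∈𝒞} y^{(C)}_r. -/
open scoped BigOperators

/-- (Product case.)  If the instance, with an exact block solver,
has a product structure over a partition `ℛ = R_1 ⊔ … ⊔ R_k` (given by `π : ℛ → Fin k`,
with `X_C = ∏_i X_i^{(C)}`), then for every part `j` it satisfies local weak duality
w.r.t. `R_j` and `μ_j := inf_{x_j ∈ 𝒳_j} ‖x_j‖_∞`. -/
theorem stmt_14 (R : Type) [Fintype R] [DecidableEq R] [Nonempty R]
    (𝒞 : Type) [Fintype 𝒞] [Nonempty 𝒞]
    (k : ℕ) (π : R → Fin k)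
    (X : 𝒞 → Set (R → ℝ))
    (hXne : ∀ c, (X c).Nonempty) (hXcl : ∀ c, IsClosed (X c))
    (hXcv : ∀ c, Convex ℝ (X c))
    (hXpos : ∀ c, ∀ x ∈ X c, ∀ r, 0 ≤ x r)
    -- the product decomposition of each block
    (Xi : (i : Fin k) → 𝒞 → Set ({r : R // π r = i} → ℝ))
    (hXine : ∀ i c, (Xi i c).Nonempty)
    (hXipos : ∀ i c, ∀ x ∈ Xi i c, ∀ r, 0 ≤ x r)
    (hXprod : ∀ c, X c = {x | ∀ i : Fin k, (fun r : {r : R // π r = i} => x r.1) ∈ Xi i c})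
    -- Minkowski sums of the components
    (𝒳i : (i : Fin k) → Set ({r : R // π r = i} → ℝ))
    (h𝒳i : ∀ i, 𝒳i i = {x | ∃ u : 𝒞 → ({r : R // π r = i} → ℝ),
      (∀ c, u c ∈ Xi i c) ∧ x = ∑ c, u c})
    (μ : Fin k → ℝ) (hμ : ∀ i, μ i = ⨅ x : 𝒳i i, ‖(x : {r : R // π r = i} → ℝ)‖)
    -- an exact block solver (σ = 1)
    (f : 𝒞 → (R → ℝ) → (R → ℝ))
    (hfmem : ∀ c y, (∀ r, 0 ≤ y r) → f c y ∈ X c)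
    (hfapx : ∀ c y, (∀ r, 0 ≤ y r) →
      ∑ r, y r * f c y r ≤ ⨅ x : X c, ∑ r, y r * (x : R → ℝ) r) :
    ∀ j : Fin k, ∀ y : 𝒞 → R → ℝ, (∀ c r, 0 ≤ y c r) →
      ∑ c, ∑ r ∈ Finset.univ.filter (fun r => π r = j), y c r * f c (y c) r ≤
        μ j * ∑ r ∈ Finset.univ.filter (fun r => π r = j), ⨆ c, y c r := by
  intro j y hy
  classical
  have hS : 0 ≤ ∑ r ∈ Finset.univ.filter (fun r => π r = j), ⨆ c, y c r :=
    Finset.sum_nonneg fun r _ => Real.iSup_nonneg fun c => hy c r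
  have hne : Nonempty (𝒳i j) := by
    choose u hu using fun c => hXine j c
    refine ⟨⟨∑ c, u c, ?_⟩⟩
    rw [h𝒳i]
    exact ⟨u, hu, rfl⟩
  rw [hμ, Real.iInf_mul_of_nonneg hS]
  refine le_ciInf ?_
  rintro ⟨z, hz⟩
  have hz' := hz
  rw [h𝒳i] at hz'
  obtain ⟨u, hu, hzu⟩ := hz'
  let x : 𝒞 → R → ℝ := fun c r => if h : π r = j then u c ⟨r, h⟩ else f c (y c) r
  have hxX : ∀ c, x c ∈ X c := by
    intro c
    have hf := hfmem c (y c) (hy c)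
    rw [hXprod] at hf ⊢
    intro i
    by_cases hi : i = j
    · subst hi
      have : (fun r : {r : R // π r = i} => x c r.1) = u c := by
        funext r
        simp [x, r.2]
      rw [this]
      exact hu c
    · have : (fun r : {r : R // π r = i} => x c r.1) = fun r => f c (y c) r.1 := by
        funext r
        have h : π r.1 ≠ j := by rw [r.2]; exact hi
        simp [x, h]
      rw [this]
      exact hf i
  have h1 : ∀ c, ∑ r ∈ Finset.univ.filter (fun r => π r = j), y c r * f c (y c) r ≤
      ∑ r ∈ Finset.univ.filter (fun r => π r = j), y c r * x c r := by
    intro c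
    have hle : ∑ r, y c r * f c (y c) r ≤ ∑ r, y c r * x c r := by
      refine (hfapx c (y c) (hy c)).trans ?_
      refine ciInf_le (f := fun x : X c => ∑ r, y c r * (x : R → ℝ) r) ⟨0, ?_⟩ ⟨x c, hxX c⟩
      rintro _ ⟨w, rfl⟩
      exact Finset.sum_nonneg fun r _ => mul_nonneg (hy c r) (hXpos c _ w.2 r)
    rw [← Finset.sum_filter_add_sum_filter_not Finset.univ (fun r => π r = j),
      ← Finset.sum_filter_add_sum_filter_not Finset.univ (fun r => π r = j)
        (fun r => y c r * x c r)] at hle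
    have heq : ∑ r ∈ Finset.univ.filter (fun r => ¬ π r = j), y c r * x c r =
        ∑ r ∈ Finset.univ.filter (fun r => ¬ π r = j), y c r * f c (y c) r := by
      refine Finset.sum_congr rfl fun r hr => ?_
      have h : ¬ π r = j := (Finset.mem_filter.1 hr).2
      simp [x, h]
    linarith
  refine (Finset.sum_le_sum fun c _ => h1 c).trans ?_
  rw [Finset.sum_comm, Finset.mul_sum]
  refine Finset.sum_le_sum fun r hr => ?_
  have hr' : π r = j := (Finset.mem_filter.1 hr).2
  have h2 : ∑ c, x c r ≤ ‖z‖ := by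
    have : ∑ c, x c r = z ⟨r, hr'⟩ := by
      rw [hzu, Finset.sum_apply]
      exact Finset.sum_congr rfl fun c _ => by simp [x, hr']
    rw [this]
    exact (le_abs_self _).trans (norm_le_pi_norm z ⟨r, hr'⟩)
  calc ∑ c, y c r * x c r ≤ ∑ c, (⨆ c, y c r) * x c r :=
        Finset.sum_le_sum fun c _ => mul_le_mul_of_nonneg_right
          (le_ciSup (f := fun c => y c r) (Set.finite_range _).bddAbove c)
          (hXpos c _ (hxX c) r)
    _ = (∑ c, x c r) * ⨆ c, y c r := by rw [← Finset.mul_sum, mul_comm]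
    _ ≤ ‖z‖ * ⨆ c, y c r :=
        mul_le_mul_of_nonneg_right h2 (Real.iSup_nonneg fun c => hy c r)
end

section
/- Let an instance of the block-angular min-max resource sharing problem with a σ-approximate block solver be given. Then in any run of the core algorithm with parameters ε > 0 and T phases, for every t ∈ {1,…,T}, the number of restricted oracle calls up to the end of phase t, i.e., the number of indices j with p_j ≤ t and ξ_j · ‖b^{(j)}‖_∞ = 1, is at most (m/ε) · log( ‖y^{(t)}‖_1 / m ). -/
open scoped BigOperators

/-- In any run of the core algorithm, for every phase `t`, the number of
restricted oracle calls up to the end of phase `t` (calls `j` with `p_j ≤ t` and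
`ξ_j ‖b^{(j)}‖_∞ = 1`) is at most `(m/ε) · log(‖y^{(t)}‖_1/m)`. -/
theorem stmt_17 (m : ℕ) (hm : 1 ≤ m)
    (𝒞 : Type) [Fintype 𝒞] [Nonempty 𝒞] [DecidableEq 𝒞]
    (X : 𝒞 → Set (Fin m → ℝ))
    (hXne : ∀ c, (X c).Nonempty) (hXcl : ∀ c, IsClosed (X c))
    (hXcv : ∀ c, Convex ℝ (X c))
    (hXpos : ∀ c, ∀ x ∈ X c, ∀ r, 0 ≤ x r)
    (σ : ℝ) (hσ : 1 ≤ σ)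
    (f : 𝒞 → (Fin m → ℝ) → (Fin m → ℝ))
    (hfmem : ∀ c y, (∀ r, 0 ≤ y r) → f c y ∈ X c)
    (hfapx : ∀ c y, (∀ r, 0 ≤ y r) →
      ∑ r, y r * f c y r ≤ σ * ⨅ x : X c, ∑ r, y r * (x : Fin m → ℝ) r)
    (ε : ℝ) (hε : 0 < ε)
    -- a run of the core algorithm with parameters ε and T
    (T : ℕ) (N : ℕ) (p : Fin N → ℕ) (Cu : Fin N → 𝒞) (ξ : Fin N → ℝ)
    (hp : ∀ j, 1 ≤ p j ∧ p j ≤ T)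
    (hpmono : ∀ j k : Fin N, j ≤ k → p j ≤ p k)
    (hξ0 : ∀ j, 0 ≤ ξ j)
    (w : ℕ → Fin m → ℝ) (hw0 : w 0 = fun _ => 1)
    (b : Fin N → Fin m → ℝ) (hb : ∀ j, b j = f (Cu j) (w j.1))
    (hwsucc : ∀ j : Fin N, w (j.1 + 1) = fun r => w j.1 r * Real.exp (ε * ξ j * b j r))
    (hstep : ∀ j, ξ j * ‖b j‖ ≤ 1)
    (hphase : ∀ t, 1 ≤ t → t ≤ T → ∀ c,
      ∑ j ∈ Finset.univ.filter (fun j => p j = t ∧ Cu j = c), ξ j = 1)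
    (y : ℕ → Fin m → ℝ)
    (hy : ∀ t, y t = w (Finset.univ.filter (fun j : Fin N => p j ≤ t)).card) :
    ∀ t, 1 ≤ t → t ≤ T →
      ((Finset.univ.filter (fun j : Fin N => p j ≤ t ∧ ξ j * ‖b j‖ = 1)).card : ℝ) ≤
        (m / ε) * Real.log ((∑ r, |y t r|) / m) := by
  intro t _ _
  have key : ∀ k : ℕ, k ≤ N → (∀ r, 0 < w k r) ∧
      ε * ((Finset.univ.filter (fun j : Fin N => j.1 < k ∧ ξ j * ‖b j‖ = 1)).card : ℝ) ≤
        ∑ r, Real.log (w k r) := by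
    intro k
    induction k with
    | zero => intro _; simp [hw0]
    | succ k ih =>
      intro hk
      obtain ⟨hpos, hle⟩ := ih (by omega)
      let j : Fin N := ⟨k, hk⟩
      have hws : w (k + 1) = fun r => w k r * Real.exp (ε * ξ j * b j r) := hwsucc j
      have hbpos : ∀ r, 0 ≤ b j r := by
        intro r
        rw [hb j]
        exact hXpos _ _ (hfmem _ _ (fun r => (hpos r).le)) r
      have hlog : ∑ r, Real.log (w (k + 1) r) =
          ∑ r, Real.log (w k r) + ε * (ξ j * ∑ r, b j r) := by
        rw [hws, Finset.mul_sum, Finset.mul_sum, ← Finset.sum_add_distrib]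
        refine Finset.sum_congr rfl fun r _ => ?_
        rw [Real.log_mul (hpos r).ne' (Real.exp_pos _).ne', Real.log_exp]
        ring
      have hsum0 : 0 ≤ ∑ r, b j r := Finset.sum_nonneg fun r _ => hbpos r
      have hnorm : ‖b j‖ ≤ ∑ r, b j r := by
        rw [pi_norm_le_iff_of_nonneg hsum0]
        intro r
        rw [Real.norm_of_nonneg (hbpos r)]
        exact Finset.single_le_sum (fun r _ => hbpos r) (Finset.mem_univ r)
      refine ⟨fun r => by rw [hws]; exact mul_pos (hpos r) (Real.exp_pos _), ?_⟩
      rw [hlog]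
      by_cases h1 : ξ j * ‖b j‖ = 1
      · have hsub : Finset.univ.filter (fun i : Fin N => i.1 < k + 1 ∧ ξ i * ‖b i‖ = 1) ⊆
            insert j (Finset.univ.filter (fun i : Fin N => i.1 < k ∧ ξ i * ‖b i‖ = 1)) := by
          intro i hi
          simp only [Finset.mem_filter, Finset.mem_univ, true_and, Finset.mem_insert] at hi ⊢
          by_cases h : i.1 = k
          · left; exact Fin.ext h
          · right; exact ⟨by omega, hi.2⟩
        have hc := (Finset.card_le_card hsub).trans (Finset.card_insert_le _ _)
        have hc' : ((Finset.univ.filter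
            (fun i : Fin N => i.1 < k + 1 ∧ ξ i * ‖b i‖ = 1)).card : ℝ) ≤
            ((Finset.univ.filter
            (fun i : Fin N => i.1 < k ∧ ξ i * ‖b i‖ = 1)).card : ℝ) + 1 := by
          exact_mod_cast hc
        have h2 : 1 ≤ ξ j * ∑ r, b j r := by
          rw [← h1]; exact mul_le_mul_of_nonneg_left hnorm (hξ0 j)
        have h3 := mul_le_mul_of_nonneg_left hc' hε.le
        have h4 := mul_le_mul_of_nonneg_left h2 hε.le
        linarith
      · have hsub : Finset.univ.filter (fun i : Fin N => i.1 < k + 1 ∧ ξ i * ‖b i‖ = 1) ⊆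
            Finset.univ.filter (fun i : Fin N => i.1 < k ∧ ξ i * ‖b i‖ = 1) := by
          intro i hi
          simp only [Finset.mem_filter, Finset.mem_univ, true_and] at hi ⊢
          by_cases h : i.1 = k
          · have : i = j := Fin.ext h
            exact absurd (this ▸ hi.2) h1
          · exact ⟨by omega, hi.2⟩
        have hc : ((Finset.univ.filter
            (fun i : Fin N => i.1 < k + 1 ∧ ξ i * ‖b i‖ = 1)).card : ℝ) ≤
            ((Finset.univ.filter
            (fun i : Fin N => i.1 < k ∧ ξ i * ‖b i‖ = 1)).card : ℝ) := by
          exact_mod_cast Finset.card_le_card hsub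
        have h3 := mul_le_mul_of_nonneg_left hc hε.le
        have h4 : 0 ≤ ε * (ξ j * ∑ r, b j r) := mul_nonneg hε.le (mul_nonneg (hξ0 j) hsum0)
        linarith
  rw [hy t]
  set K := (Finset.univ.filter (fun j : Fin N => p j ≤ t)).card with hK
  have hKN : K ≤ N := by
    have := Finset.card_le_univ (Finset.univ.filter (fun j : Fin N => p j ≤ t))
    simpa using this
  obtain ⟨hpos, hle⟩ := key K hKN
  have hsub : Finset.univ.filter (fun j : Fin N => p j ≤ t ∧ ξ j * ‖b j‖ = 1) ⊆
      Finset.univ.filter (fun j : Fin N => j.1 < K ∧ ξ j * ‖b j‖ = 1) := by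
    intro j hj
    simp only [Finset.mem_filter, Finset.mem_univ, true_and] at hj ⊢
    refine ⟨?_, hj.2⟩
    have h : Finset.Iic j ⊆ Finset.univ.filter (fun j : Fin N => p j ≤ t) := by
      intro i hi
      simp only [Finset.mem_filter, Finset.mem_univ, true_and, Finset.mem_Iic] at hi ⊢
      exact (hpmono i j hi).trans hj.1
    have h' := Finset.card_le_card h
    rw [Fin.card_Iic] at h'
    omega
  have hc : ((Finset.univ.filter (fun j : Fin N => p j ≤ t ∧ ξ j * ‖b j‖ = 1)).card : ℝ) ≤
      ((Finset.univ.filter (fun j : Fin N => j.1 < K ∧ ξ j * ‖b j‖ = 1)).card : ℝ) := by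
    exact_mod_cast Finset.card_le_card hsub
  have habs : ∑ r, |w K r| = ∑ r, w K r :=
    Finset.sum_congr rfl fun r _ => abs_of_pos (hpos r)
  rw [habs]
  have hm0 : (0 : ℝ) < m := by exact_mod_cast hm
  have hS : 0 < ∑ r, w K r :=
    Finset.sum_pos (fun r _ => hpos r) ⟨⟨0, hm⟩, Finset.mem_univ _⟩
  set A := (∑ r, w K r) / m with hA
  have hA0 : 0 < A := div_pos hS hm0
  have hjen : ∑ r, Real.log (w K r) ≤ m * Real.log A := by
    have h1 : ∀ r ∈ Finset.univ, Real.log (w K r) ≤ w K r / A + (Real.log A - 1) := by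
      intro r _
      have := Real.log_le_sub_one_of_pos (div_pos (hpos r) hA0)
      rw [Real.log_div (hpos r).ne' hA0.ne'] at this
      linarith
    have h2 := Finset.sum_le_sum h1
    rw [Finset.sum_add_distrib, ← Finset.sum_div] at h2
    have h3 : (∑ r, w K r) / A = m := by
      rw [hA]; field_simp
    rw [h3] at h2
    simp only [Finset.sum_const, Finset.card_univ, Fintype.card_fin, nsmul_eq_mul] at h2
    linarith
  rw [div_mul_eq_mul_div, le_div_iff₀ hε]
  have := mul_le_mul_of_nonneg_left hc hε.le
  linarith
end

section
/- Let an instance of the block-angular min-max resource sharing problem with a σ-approximate block solver be given with λ* > 0, and let ε > 0 satisfy ε ≤ 1/(4 σ λ*). Let k ∈ ℕ, let C_1,…,C_k ∈ 𝒞 and ξ_1,…,ξ_k ≥ 0 satisfy ∑_{j : C_j = C} ξ_j ≤ 1 for every C ∈ 𝒞. Let y^{(0)} ∈ ℝ^ℛ_{≥0} and define recursively y^{(j)}_r := y^{(j−1)}_r · exp(ε ξ_j b^{(j)}_r) for all r ∈ ℛ, where b^{(j)} := f_{C_j}(y^{(j−1)}), and assume ε ξ_j b^{(j)}_r ≤ 1/(4σ)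 for all j and all r ∈ ℛ. Then ‖y^{(k)}‖_1 ≤ 2 ‖y^{(0)}‖_1. -/
open scoped BigOperators

/-- (Price doubling bound.)  If `ε ≤ 1/(4σλ*)` and every multiplicative
price update in a phase satisfies `ε ξ_j b^{(j)}_r ≤ 1/(4σ)`, with step sizes summing to
at most `1` per customer, then the `ℓ₁`-norm of the prices at most doubles:
`‖y^{(k)}‖_1 ≤ 2‖y^{(0)}‖_1`. -/
theorem stmt_18 (m : ℕ) (hm : 1 ≤ m)
    (𝒞 : Type) [Fintype 𝒞] [Nonempty 𝒞] [DecidableEq 𝒞]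
    (X : 𝒞 → Set (Fin m → ℝ))
    (hXne : ∀ c, (X c).Nonempty) (hXcl : ∀ c, IsClosed (X c))
    (hXcv : ∀ c, Convex ℝ (X c))
    (hXpos : ∀ c, ∀ x ∈ X c, ∀ r, 0 ≤ x r)
    (𝒳 : Set (Fin m → ℝ))
    (h𝒳 : 𝒳 = {x | ∃ g : 𝒞 → Fin m → ℝ, (∀ c, g c ∈ X c) ∧ x = ∑ c, g c})
    (lam : ℝ) (hlam : lam = ⨅ x : 𝒳, ‖(x : Fin m → ℝ)‖) (hlam_pos : 0 < lam)
    (σ : ℝ) (hσ : 1 ≤ σ)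
    (f : 𝒞 → (Fin m → ℝ) → (Fin m → ℝ))
    (hfmem : ∀ c y, (∀ r, 0 ≤ y r) → f c y ∈ X c)
    (hfapx : ∀ c y, (∀ r, 0 ≤ y r) →
      ∑ r, y r * f c y r ≤ σ * ⨅ x : X c, ∑ r, y r * (x : Fin m → ℝ) r)
    (ε : ℝ) (hε : 0 < ε) (hεlam : ε ≤ 1 / (4 * σ * lam))
    -- the sequence of oracle calls
    (k : ℕ) (Cu : Fin k → 𝒞) (ξ : Fin k → ℝ) (hξ0 : ∀ j, 0 ≤ ξ j)
    (hξsum : ∀ c, ∑ j ∈ Finset.univ.filter (fun j => Cu j = c), ξ j ≤ 1)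
    (y : ℕ → Fin m → ℝ) (hy0 : ∀ r, 0 ≤ y 0 r)
    (b : Fin k → Fin m → ℝ) (hb : ∀ j, b j = f (Cu j) (y j.1))
    (hysucc : ∀ j : Fin k, y (j.1 + 1) = fun r => y j.1 r * Real.exp (ε * ξ j * b j r))
    (hsmall : ∀ j r, ε * ξ j * b j r ≤ 1 / (4 * σ)) :
    ∑ r, |y k r| ≤ 2 * ∑ r, |y 0 r| := by
  have hσ0 : 0 < σ := by linarith
  have hη : 1 / (4 * σ) ≤ 1 / 4 := by
    apply one_div_le_one_div_of_le <;> linarith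
  -- nonnegativity of prices
  have hypos : ∀ n, n ≤ k → ∀ r, 0 ≤ y n r := by
    intro n
    induction n with
    | zero => intro _ r; exact hy0 r
    | succ n ih =>
      intro hn r
      have h := hysucc ⟨n, hn⟩
      simp only at h
      rw [h]
      exact mul_nonneg (ih (by omega) r) (Real.exp_pos _).le
  have hbpos : ∀ j r, 0 ≤ b j r := by
    intro j r
    rw [hb]
    exact hXpos _ _ (hfmem _ _ (hypos j.1 j.2.le)) r
  have hstep : ∀ n, n < k → ∀ r, y n r ≤ y (n + 1) r := by
    intro n hn r
    have h := hysucc ⟨n, hn⟩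
    simp only at h
    rw [h]
    apply le_mul_of_one_le_right (hypos n hn.le r)
    exact Real.one_le_exp (mul_nonneg (mul_nonneg hε.le (hξ0 _)) (hbpos _ r))
  have hmono : ∀ d n, n + d ≤ k → ∀ r, y n r ≤ y (n + d) r := by
    intro d
    induction d with
    | zero => intro n _ r; exact le_rfl
    | succ d ih =>
      intro n hn r
      exact (ih n (by omega) r).trans (hstep (n + d) (by omega) r)
  have hmonok : ∀ j : Fin k, ∀ r, y j.1 r ≤ y k r := by
    intro j r
    have h := hmono (k - j.1) j.1 (by omega) r
    rwa [show j.1 + (k - j.1) = k by omega] at h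
  have hne : ∀ c, Nonempty (X c) := fun c => (hXne c).to_subtype
  have hbdd : ∀ c (z : Fin m → ℝ), (∀ r, 0 ≤ z r) →
      BddBelow (Set.range fun x : X c => ∑ r, z r * (x : Fin m → ℝ) r) := by
    intro c z hz
    refine ⟨0, ?_⟩
    rintro _ ⟨x, rfl⟩
    exact Finset.sum_nonneg fun r _ => mul_nonneg (hz r) (hXpos c x x.2 r)
  set opt : 𝒞 → ℝ := fun c => ⨅ x : X c, ∑ r, y k r * (x : Fin m → ℝ) r with hopt
  have hyk := hypos k le_rfl
  have hopt0 : ∀ c, 0 ≤ opt c := fun c =>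
    Real.iInf_nonneg fun x => Finset.sum_nonneg fun r _ =>
      mul_nonneg (hyk r) (hXpos c x x.2 r)
  have hbopt : ∀ j : Fin k, ∑ r, y j.1 r * b j r ≤ σ * opt (Cu j) := by
    intro j
    have hj := hypos j.1 j.2.le
    rw [hb]
    refine (hfapx _ _ hj).trans (mul_le_mul_of_nonneg_left ?_ hσ0.le)
    refine ciInf_mono (hbdd _ _ hj) fun x => ?_
    exact Finset.sum_le_sum fun r _ =>
      mul_le_mul_of_nonneg_right (hmonok j r) (hXpos _ x x.2 r)
  -- weak duality
  have hdual : ∑ c, opt c ≤ lam * ∑ r, y k r := by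
    have hS : 0 ≤ ∑ r, y k r := Finset.sum_nonneg fun r _ => hyk r
    have hneX : Nonempty 𝒳 := by
      choose g hg using hXne
      exact ⟨⟨∑ c, g c, by rw [h𝒳]; exact ⟨g, hg, rfl⟩⟩⟩
    rw [hlam, Real.iInf_mul_of_nonneg hS]
    refine le_ciInf ?_
    rintro ⟨x, hx⟩
    rw [h𝒳] at hx
    obtain ⟨g, hg, hxg⟩ := hx
    calc ∑ c, opt c ≤ ∑ c, ∑ r, y k r * g c r :=
          Finset.sum_le_sum fun c _ => ciInf_le (hbdd c _ hyk) ⟨g c, hg c⟩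
      _ = ∑ r, y k r * x r := by
          rw [Finset.sum_comm]
          refine Finset.sum_congr rfl fun r _ => ?_
          rw [hxg, Finset.sum_apply, Finset.mul_sum]
      _ ≤ ∑ r, y k r * ‖x‖ := Finset.sum_le_sum fun r _ =>
          mul_le_mul_of_nonneg_left ((le_abs_self _).trans (norm_le_pi_norm x r)) (hyk r)
      _ = ‖x‖ * ∑ r, y k r := by rw [← Finset.sum_mul, mul_comm]
  have hξopt : ∑ j, ξ j * opt (Cu j) ≤ ∑ c, opt c := by
    rw [← Finset.sum_fiberwise (s := Finset.univ) (g := Cu)]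
    refine Finset.sum_le_sum fun c _ => ?_
    calc ∑ j ∈ Finset.univ.filter (fun j => Cu j = c), ξ j * opt (Cu j)
        = ∑ j ∈ Finset.univ.filter (fun j => Cu j = c), ξ j * opt c := by
          refine Finset.sum_congr rfl fun j hj => ?_
          rw [(Finset.mem_filter.1 hj).2]
      _ = (∑ j ∈ Finset.univ.filter (fun j => Cu j = c), ξ j) * opt c := by
          rw [Finset.sum_mul]
      _ ≤ opt c := mul_le_of_le_one_left (hopt0 c) (hξsum c)
  have hexp : ∀ x : ℝ, 0 ≤ x → x ≤ 1 / 4 → Real.exp x ≤ 1 + 5 / 4 * x := by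
    intro x h0 h1
    have h := (abs_le.1 (Real.abs_exp_sub_one_sub_id_le
      (show |x| ≤ 1 by rw [abs_of_nonneg h0]; linarith))).2
    nlinarith
  have hinc : ∀ j : Fin k, ∑ r, y (j.1 + 1) r - ∑ r, y j.1 r
      ≤ 5 / 4 * ε * σ * (ξ j * opt (Cu j)) := by
    intro j
    have h1 : ∑ r, y (j.1 + 1) r ≤ ∑ r, (y j.1 r + 5 / 4 * ε * ξ j * (y j.1 r * b j r)) := by
      refine Finset.sum_le_sum fun r _ => ?_
      rw [hysucc]
      have h := mul_le_mul_of_nonneg_left (hexp _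
        (mul_nonneg (mul_nonneg hε.le (hξ0 j)) (hbpos j r))
        ((hsmall j r).trans hη)) (hypos j.1 j.2.le r)
      refine h.trans (le_of_eq ?_)
      ring
    rw [Finset.sum_add_distrib, ← Finset.mul_sum] at h1
    have h2 := mul_le_mul_of_nonneg_left (hbopt j)
      (show 0 ≤ 5 / 4 * ε * ξ j from mul_nonneg (by positivity) (hξ0 j))
    linarith
  have htel : ∑ r, y k r - ∑ r, y 0 r ≤ 5 / 4 * ε * σ * ∑ j, ξ j * opt (Cu j) := by
    rw [← Finset.sum_range_sub (fun n => ∑ r, y n r) k,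
      ← Fin.sum_univ_eq_sum_range (fun n => ∑ r, y (n + 1) r - ∑ r, y n r) k, Finset.mul_sum]
    exact Finset.sum_le_sum fun j _ => hinc j
  have hS : 0 ≤ ∑ r, y k r := Finset.sum_nonneg fun r _ => hyk r
  have hc : 5 / 4 * ε * σ * ∑ j, ξ j * opt (Cu j) ≤ 5 / 4 * ε * σ * (lam * ∑ r, y k r) :=
    mul_le_mul_of_nonneg_left (hξopt.trans hdual) (by positivity)
  have hel : ε * (4 * σ * lam) ≤ 1 := (le_div_iff₀ (by positivity)).1 hεlam
  have hfin := mul_le_mul_of_nonneg_right hel hS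
  have e1 : ∑ r, |y k r| = ∑ r, y k r := Finset.sum_congr rfl fun r _ => abs_of_nonneg (hyk r)
  have e2 : ∑ r, |y 0 r| = ∑ r, y 0 r := Finset.sum_congr rfl fun r _ => abs_of_nonneg (hy0 r)
  rw [e1, e2]
  have h0 : 0 ≤ ∑ r, y 0 r := Finset.sum_nonneg fun r _ => hy0 r
  linarith
end
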